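/- arXiv:2211.05954 — 4 statements merged into one kernel-verified Lean document; each statement's English description precedes it below -/
import Mathlib

section
/- Consider the Gaussian sequence model with noise level σₙ and the parameter space Θ^A(kₙ, τₙ) = {θ ∈ ℝⁿ : ‖θ‖₀ ≤ kₙ, ‖θ‖₂² ≤ kₙ τₙ², ‖θ‖_∞ ≤ A τₙ}. Suppose εₙ = kₙ/n → 0, μₙ = τₙ/σₙ → ∞ and μₙ = o(√(log εₙ⁻¹)) as n → ∞. Then for any constant A > 1, the minimax risk satisfies R(Θ^A(kₙ,τₙ), σₙ) = n σₙ² ( εₙ μₙ² − (1/2) εₙ² μₙ² e^{μₙ²} (1+o(1)) ). -/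
open MeasureTheory ProbabilityTheory Filter
open scoped ENNReal NNReal Topology

noncomputable section

/-- Gaussian sequence model: the law of `y` under parameter `θ`, the product of
the Gaussians `N(θ i, σ²)`. -/
def gsm (n : ℕ) (θ : Fin n → ℝ) (σ : ℝ) : Measure (Fin n → ℝ) :=
  MeasureTheory.Measure.pi fun i => gaussianReal (θ i) ((σ ^ 2).toNNReal)

/-- Squared-error risk `E_θ ‖est(y) − θ‖₂²` of an estimator at parameter `θ`. -/
def risk (n : ℕ) (σ : ℝ) (est : (Fin n → ℝ) → Fin n → ℝ) (θ : Fin n → ℝ) : ℝ≥0∞ :=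
  ∫⁻ y, ENNReal.ofReal (∑ i, (est y i - θ i) ^ 2) ∂(gsm n θ σ)

/-- The SNR-aware parameter space `Θ(k,τ) = {θ : ‖θ‖₀ ≤ k, ‖θ‖₂² ≤ k τ²}`. -/
def paramSet (n k : ℕ) (τ : ℝ) : Set (Fin n → ℝ) :=
  {θ | {i | θ i ≠ 0}.ncard ≤ k ∧ ∑ i, (θ i) ^ 2 ≤ (k : ℝ) * τ ^ 2}

/-- Minimax risk: infimum over measurable estimators of the supremum risk over `Θ`. -/
def minimaxRisk (n : ℕ) (σ : ℝ) (Θ : Set (Fin n → ℝ)) : ℝ≥0∞ :=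
  ⨅ (est : (Fin n → ℝ) → Fin n → ℝ) (_ : Measurable est), ⨆ θ ∈ Θ, risk n σ est θ

/-- Bounded SNR-aware parameter space
`Θ^A(k,τ) = {θ : ‖θ‖₀ ≤ k, ‖θ‖₂² ≤ k τ², ‖θ‖_∞ ≤ A τ}`. -/
def paramSetA (n k : ℕ) (τ A : ℝ) : Set (Fin n → ℝ) :=
  {θ | {i | θ i ≠ 0}.ncard ≤ k ∧ ∑ i, (θ i) ^ 2 ≤ (k : ℝ) * τ ^ 2 ∧ ∀ i, |θ i| ≤ A * τ}

lemma integ_exp (θ : ℝ) (v : ℝ≥0) (t : ℝ) :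
    ∫ y, Real.exp (t * y) ∂(gaussianReal θ v) = Real.exp (θ * t + v * t ^ 2 / 2) := by
  have h := congrFun (mgf_id_gaussianReal (μ := θ) (v := v)) t
  simpa [mgf] using h

lemma coord_risk (θ : ℝ) (v : ℝ≥0) (a b : ℝ) :
    Integrable (fun y => (a * Real.sinh (b * y) - θ) ^ 2) (gaussianReal θ v) ∧
    ∫ y, (a * Real.sinh (b * y) - θ) ^ 2 ∂(gaussianReal θ v) =
      a ^ 2 * (1 / 2) * (Real.exp (2 * (v * b ^ 2)) * Real.cosh (2 * (b * θ)) - 1)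
      - 2 * θ * a * (Real.exp (v * b ^ 2 / 2) * Real.sinh (b * θ)) + θ ^ 2 := by
  have e : (fun y => (a * Real.sinh (b * y) - θ) ^ 2) = fun y =>
      (a ^ 2 / 4 * Real.exp ((2 * b) * y) + a ^ 2 / 4 * Real.exp ((-2 * b) * y)
        - a * θ * Real.exp (b * y) + a * θ * Real.exp ((-b) * y)) + (θ ^ 2 - a ^ 2 / 2) := by
    ext y
    have h1 : Real.exp ((2 * b) * y) = Real.exp (b * y) ^ 2 := by
      rw [← Real.exp_nat_mul]; congr 1; push_cast; ring
    have h2 : Real.exp ((-2 * b) * y) = Real.exp ((-b) * y) ^ 2 := by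
      rw [← Real.exp_nat_mul]; congr 1; push_cast; ring
    have h3 : Real.exp (b * y) * Real.exp ((-b) * y) = 1 := by
      rw [← Real.exp_add, ← Real.exp_zero]; congr 1; ring
    rw [Real.sinh_eq, h1, h2]
    have h4 : -(b * y) = (-b) * y := by ring
    rw [h4]
    linear_combination (-a ^ 2 / 2) * h3
  have i1 := fun t => integrable_exp_mul_gaussianReal (μ := θ) (v := v) t
  have j1 := (i1 (2 * b)).const_mul (a ^ 2 / 4)
  have j2 := (i1 (-2 * b)).const_mul (a ^ 2 / 4)
  have j3 := (i1 b).const_mul (a * θ)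
  have j4 := (i1 (-b)).const_mul (a * θ)
  have j12 : Integrable (fun x => a ^ 2 / 4 * Real.exp ((2 * b) * x) +
      a ^ 2 / 4 * Real.exp ((-2 * b) * x)) (gaussianReal θ v) := j1.add j2
  have j123 : Integrable (fun x => a ^ 2 / 4 * Real.exp ((2 * b) * x) +
      a ^ 2 / 4 * Real.exp ((-2 * b) * x) - a * θ * Real.exp (b * x)) (gaussianReal θ v) :=
    j12.sub j3
  have j1234 : Integrable (fun x => a ^ 2 / 4 * Real.exp ((2 * b) * x) +
      a ^ 2 / 4 * Real.exp ((-2 * b) * x) - a * θ * Real.exp (b * x)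
      + a * θ * Real.exp ((-b) * x)) (gaussianReal θ v) :=
    j123.add j4
  rw [e]
  refine ⟨(((j1.add j2).sub j3).add j4).add (integrable_const _), ?_⟩
  rw [integral_add j1234 (integrable_const _),
    integral_add j123 j4, integral_sub j12 j3, integral_add j1 j2]
  simp only [integral_const_mul, integ_exp, integral_const, probReal_univ, smul_eq_mul]
  rw [Real.cosh_eq, Real.sinh_eq]
  have k1 : Real.exp (θ * (2 * b) + v * (2 * b) ^ 2 / 2) =
      Real.exp (2 * (v * b ^ 2)) * Real.exp (2 * (b * θ)) := by
    rw [← Real.exp_add]; congr 1; ring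
  have k2 : Real.exp (θ * (-2 * b) + v * (-2 * b) ^ 2 / 2) =
      Real.exp (2 * (v * b ^ 2)) * Real.exp (-(2 * (b * θ))) := by
    rw [← Real.exp_add]; congr 1; ring
  have k3 : Real.exp (θ * b + v * b ^ 2 / 2) =
      Real.exp (v * b ^ 2 / 2) * Real.exp (b * θ) := by
    rw [← Real.exp_add]; congr 1; ring
  have k4 : Real.exp (θ * (-b) + v * (-b) ^ 2 / 2) =
      Real.exp (v * b ^ 2 / 2) * Real.exp (-(b * θ)) := by
    rw [← Real.exp_add]; congr 1; ring
  rw [k1, k2, k3, k4]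
  ring

lemma key_ineq (s t : ℝ) (hs : 1 ≤ s) (ht : 0 ≤ t) :
    s * Real.exp s + (s + 1) / (2 * s) * Real.exp s * (t ^ 2 - s ^ 2) - t ≤
      2 * (t * Real.sinh t) := by
  have h1 : Real.exp s * (1 + (t - s)) ≤ Real.exp t := by
    have := Real.add_one_le_exp (t - s)
    calc Real.exp s * (1 + (t - s)) ≤ Real.exp s * Real.exp (t - s) := by gcongr; linarith
      _ = Real.exp t := by rw [← Real.exp_add]; congr 1; ring
  have h2 : Real.exp (-t) ≤ 1 := by rw [Real.exp_le_one_iff]; linarith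
  have h3 : 2 * (t * Real.sinh t) ≥ t * (Real.exp t - 1) := by
    rw [Real.sinh_eq]; nlinarith
  have h4 : t * (Real.exp s * (1 + (t - s))) ≤ t * Real.exp t := by gcongr
  have h5 : t * (Real.exp s * (1 + (t - s))) - (s * Real.exp s + (s + 1) / (2 * s) * Real.exp s * (t ^ 2 - s ^ 2)) = Real.exp s * ((t - s) ^ 2 * (s - 1) / (2 * s)) := by
    field_simp; ring
  have h6 : 0 ≤ Real.exp s * ((t - s) ^ 2 * (s - 1) / (2 * s)) := by
    have : 0 ≤ s - 1 := by linarith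
    positivity
  nlinarith

lemma upper_bound (n k : ℕ) (τ σ A : ℝ) (hk : 1 ≤ k) (hkn : k ≤ n) (hτ : 0 < τ) (hσ : 0 < σ)
    (hA : 1 < A) (s ε : ℝ) (hs : s = τ ^ 2 / σ ^ 2) (hε : ε = (k : ℝ) / n) (hs1 : 1 ≤ s)
    (hq : ε * (s + 1) * Real.exp s ≤ 2) :
    minimaxRisk n σ (paramSetA n k τ A) ≤ ENNReal.ofReal (k * τ ^ 2 *
      (1 - 1 / 2 * ε * Real.exp s * (1 - 2 * A * Real.exp (-s) - ε * Real.exp (2 * A * s)))) := by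
  set b := τ / σ ^ 2 with hb
  set a := ε * τ * Real.exp (-s / 2) with ha
  have hn0 : (0 : ℝ) < n := by exact_mod_cast (by omega : 0 < n)
  have hε0 : 0 ≤ ε := by rw [hε]; positivity
  have hnε : n * ε = k := by rw [hε]; field_simp
  have hσs : σ ^ 2 * s = τ ^ 2 := by rw [hs]; field_simp
  have hvb : σ ^ 2 * b ^ 2 = s := by rw [hs, hb]; field_simp
  have hm : Measurable (fun (y : Fin n → ℝ) (i : Fin n) => a * Real.sinh (b * y i)) := by
    fun_prop
  unfold _root_.minimaxRisk
  refine iInf₂_le_of_le _ hm (iSup₂_le fun θ hθ => ?_)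
  obtain ⟨h0, h2, hinf⟩ := hθ
  -- risk computation
  have hrisk : risk n σ (fun y i => a * Real.sinh (b * y i)) θ = ENNReal.ofReal (∑ i,
      ∫ y, (a * Real.sinh (b * y) - θ i) ^ 2 ∂(gaussianReal (θ i) ((σ ^ 2).toNNReal))) := by
    unfold risk
    rw [ENNReal.ofReal_sum_of_nonneg (fun i _ => integral_nonneg fun y => sq_nonneg _)]
    have : ∀ y : Fin n → ℝ, ENNReal.ofReal (∑ i, (a * Real.sinh (b * y i) - θ i) ^ 2) =
        ∑ i, ENNReal.ofReal ((a * Real.sinh (b * y i) - θ i) ^ 2) := fun y =>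
      ENNReal.ofReal_sum_of_nonneg (fun i _ => sq_nonneg _)
    simp_rw [this]
    rw [lintegral_finsetSum _ (fun i _ => by fun_prop)]
    refine Finset.sum_congr rfl fun i _ => ?_
    rw [ofReal_integral_eq_lintegral_ofReal (coord_risk _ _ _ _).1
      (Eventually.of_forall fun y => sq_nonneg _)]
    have mp := measurePreserving_eval (fun i => gaussianReal (θ i) ((σ ^ 2).toNNReal)) i
    exact mp.lintegral_comp (f := fun y => ENNReal.ofReal ((a * Real.sinh (b * y) - θ i) ^ 2))
      (by fun_prop)
  rw [hrisk]
  apply ENNReal.ofReal_le_ofReal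
  -- the set T
  obtain ⟨T, hT1, hT2⟩ : ∃ T : Finset (Fin n), (∀ i, i ∉ T → θ i = 0) ∧ T.card = k := by
    have hc : (Finset.univ.filter (fun i => θ i ≠ 0)).card ≤ k := by
      rw [← Set.ncard_coe_finset]; simpa using h0
    obtain ⟨T, hT, -, hT'⟩ := Finset.exists_subsuperset_card_eq
      (Finset.subset_univ (Finset.univ.filter (fun i => θ i ≠ 0))) hc (by simpa using hkn)
    refine ⟨T, fun i hi => ?_, hT'⟩
    by_contra h
    exact hi (hT (by simp [h]))
  have hval : ∀ i, ∫ y, (a * Real.sinh (b * y) - θ i) ^ 2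
      ∂(gaussianReal (θ i) ((σ ^ 2).toNNReal)) =
      1 / 2 * ε ^ 2 * τ ^ 2 * (Real.exp s * Real.cosh (2 * (b * θ i)) - Real.exp (-s))
        - 2 * ε * τ * (θ i * Real.sinh (b * θ i)) + θ i ^ 2 := by
    intro i
    rw [(coord_risk _ _ _ _).2, Real.coe_toNNReal _ (sq_nonneg σ), hvb]
    have e1 : Real.exp (-s/2) ^ 2 = Real.exp (-s) := by
      rw [← Real.exp_nat_mul]; congr 1; push_cast; ring
    have e2 : Real.exp (-s) * Real.exp (2 * s) = Real.exp s := by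
      rw [← Real.exp_add]; congr 1; ring
    have e3 : Real.exp (-s/2) * Real.exp (s/2) = 1 := by
      rw [← Real.exp_add, ← Real.exp_zero]; congr 1; ring
    rw [ha, mul_pow, e1]
    linear_combination (1 / 2 * ε ^ 2 * τ ^ 2 * Real.cosh (2 * (b * θ i))) * e2
      - (2 * ε * τ * (θ i * Real.sinh (b * θ i))) * e3
  simp_rw [hval]
  set C := 1 / 2 * ε ^ 2 * τ ^ 2 * Real.exp s with hC
  have hb0 : 0 < b := by positivity
  have hper : ∀ i, 1 / 2 * ε ^ 2 * τ ^ 2 * (Real.exp s * Real.cosh (2 * (b * θ i)) - Real.exp (-s))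
        - 2 * ε * τ * (θ i * Real.sinh (b * θ i)) + θ i ^ 2 ≤
      C + if i ∈ T then (C * Real.exp (2 * A * s) + θ i ^ 2 - ε * τ ^ 2 * Real.exp s
        - ε * (s + 1) / 2 * Real.exp s * (θ i ^ 2 - τ ^ 2) + ε * A * τ ^ 2) else 0 := by
    intro i
    have hpos : 0 ≤ 1 / 2 * ε ^ 2 * τ ^ 2 * Real.exp (-s) := by positivity
    have hC0 : 0 ≤ C := by positivity
    split_ifs with hi
    · have hbt : |b * θ i| ≤ A * s := by
        rw [abs_mul, abs_of_pos hb0]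
        calc b * |θ i| ≤ b * (A * τ) := by gcongr; exact hinf i
          _ = A * s := by rw [hb, hs]; field_simp
      have hcosh : Real.cosh (2 * (b * θ i)) ≤ Real.exp (2 * A * s) := by
        rw [← Real.cosh_abs, Real.cosh_eq]
        have h1 : |2 * (b * θ i)| ≤ 2 * A * s := by rw [abs_mul, abs_two]; linarith
        have h2 : Real.exp (|2 * (b * θ i)|) ≤ Real.exp (2 * A * s) := Real.exp_le_exp.2 h1
        have h3 : Real.exp (-|2 * (b * θ i)|) ≤ Real.exp (2 * A * s) :=
          Real.exp_le_exp.2 (by have := abs_nonneg (2 * (b * θ i)); linarith)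
        linarith
      have hk1 := key_ineq s |b * θ i| hs1 (abs_nonneg _)
      have hts : |b * θ i| * Real.sinh |b * θ i| = b * θ i * Real.sinh (b * θ i) := by
        rcases abs_cases (b * θ i) with ⟨h, -⟩ | ⟨h, -⟩ <;> rw [h]
        rw [Real.sinh_neg]; ring
      rw [hts, sq_abs] at hk1
      have hk2 := mul_le_mul_of_nonneg_left hk1 (by positivity : 0 ≤ ε * σ ^ 2)
      have e1 : ε * σ ^ 2 * (2 * (b * θ i * Real.sinh (b * θ i))) =
          2 * ε * τ * (θ i * Real.sinh (b * θ i)) := by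
        rw [hb]; field_simp
      have e2 : ε * σ ^ 2 * (s * Real.exp s + (s + 1) / (2 * s) * Real.exp s *
          ((b * θ i) ^ 2 - s ^ 2) - |b * θ i|) = ε * (σ ^ 2 * s) * Real.exp s +
          ε * (s + 1) / 2 * Real.exp s * ((σ ^ 2 * b ^ 2 * θ i ^ 2 - (σ ^ 2 * s) * s) / s)
            - ε * σ ^ 2 * |b * θ i| := by
        field_simp
      rw [e1, e2, hvb, hσs] at hk2
      have e3 : (s * θ i ^ 2 - τ ^ 2 * s) / s = θ i ^ 2 - τ ^ 2 := by field_simp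
      rw [e3] at hk2
      have e4 : ε * σ ^ 2 * |b * θ i| ≤ ε * A * τ ^ 2 := by
        calc ε * σ ^ 2 * |b * θ i| ≤ ε * σ ^ 2 * (A * s) := by gcongr
          _ = ε * A * (σ ^ 2 * s) := by ring
          _ = _ := by rw [hσs]
      have e5 : C * Real.cosh (2 * (b * θ i)) ≤ C * Real.exp (2 * A * s) := by gcongr
      have e6 : 1 / 2 * ε ^ 2 * τ ^ 2 * (Real.exp s * Real.cosh (2 * (b * θ i)) - Real.exp (-s)) =
        C * Real.cosh (2 * (b * θ i)) - 1 / 2 * ε ^ 2 * τ ^ 2 * Real.exp (-s) := by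
        rw [hC]; ring
      linarith
    · rw [hT1 i hi]
      simp only [mul_zero, Real.cosh_zero, Real.sinh_zero, mul_one]
      rw [hC]; nlinarith
  refine (Finset.sum_le_sum fun i _ => hper i).trans ?_
  rw [Finset.sum_add_distrib, Finset.sum_ite_mem, Finset.univ_inter]
  have hsT : ∑ i ∈ T, θ i ^ 2 ≤ k * τ ^ 2 := by
    refine le_trans ?_ h2
    exact Finset.sum_le_univ_sum_of_nonneg fun i => sq_nonneg _
  have hsum : ∑ i ∈ T, (C * Real.exp (2 * A * s) + θ i ^ 2 - ε * τ ^ 2 * Real.exp s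
        - ε * (s + 1) / 2 * Real.exp s * (θ i ^ 2 - τ ^ 2) + ε * A * τ ^ 2) =
      k * (C * Real.exp (2 * A * s) - ε * τ ^ 2 * Real.exp s + ε * A * τ ^ 2) +
        ∑ i ∈ T, θ i ^ 2 - ε * (s + 1) / 2 * Real.exp s * (∑ i ∈ T, θ i ^ 2 - k * τ ^ 2) := by
    simp only [Finset.sum_add_distrib, Finset.sum_sub_distrib, ← Finset.mul_sum, Finset.sum_const,
      hT2, nsmul_eq_mul]
    ring
  rw [hsum]
  simp only [Finset.sum_const, Finset.card_univ, Fintype.card_fin, nsmul_eq_mul]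
  have f1 : (1 - ε * (s + 1) / 2 * Real.exp s) * (∑ i ∈ T, θ i ^ 2 - k * τ ^ 2) ≤ 0 := by
    apply mul_nonpos_of_nonneg_of_nonpos <;> linarith
  have f2 : n * C = 1 / 2 * k * ε * τ ^ 2 * Real.exp s := by
    rw [hC, ← hnε]; ring
  have f3 : Real.exp s * Real.exp (-s) = 1 := by rw [← Real.exp_add]; simp
  rw [f2]
  have f4 : k * τ ^ 2 *
      (1 - 1 / 2 * ε * Real.exp s * (1 - 2 * A * Real.exp (-s) - ε * Real.exp (2 * A * s))) =
      k * τ ^ 2 - 1 / 2 * k * ε * τ ^ 2 * Real.exp s + k * τ ^ 2 * ε * A +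
        k * (C * Real.exp (2 * A * s)) := by
    rw [hC]; linear_combination (k * τ ^ 2 * ε * A) * f3
  rw [f4]
  nlinarith

lemma cosh_int (v : ℝ≥0) (b : ℝ) :
    Integrable (fun y => Real.cosh (b * y)) (gaussianReal 0 v) ∧
    ∫ y, Real.cosh (b * y) ∂(gaussianReal 0 v) = Real.exp (v * b ^ 2 / 2) := by
  have e : (fun y => Real.cosh (b * y)) = fun y =>
      1 / 2 * Real.exp (b * y) + 1 / 2 * Real.exp ((-b) * y) := by
    ext y; rw [Real.cosh_eq, neg_mul]; ring
  have j1 := (integrable_exp_mul_gaussianReal (μ := 0) (v := v) b).const_mul (1 / 2)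
  have j2 := (integrable_exp_mul_gaussianReal (μ := 0) (v := v) (-b)).const_mul (1 / 2)
  rw [e]
  refine ⟨j1.add j2, ?_⟩
  rw [integral_add j1 j2]
  simp only [integral_const_mul, integ_exp, neg_sq]
  simp only [zero_mul, zero_add]; ring

lemma cosh_sq_int (v : ℝ≥0) (b : ℝ) :
    Integrable (fun y => Real.cosh (b * y) ^ 2) (gaussianReal 0 v) ∧
    ∫ y, Real.cosh (b * y) ^ 2 ∂(gaussianReal 0 v) = (Real.exp (2 * (v * b ^ 2)) + 1) / 2 := by
  have e : (fun y => Real.cosh (b * y) ^ 2) = fun y =>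
      1 / 2 * Real.cosh ((2 * b) * y) + 1 / 2 := by
    ext y
    rw [mul_assoc, Real.cosh_two_mul, Real.sinh_sq]; ring
  obtain ⟨i, h⟩ := cosh_int v (2 * b)
  rw [e]
  refine ⟨(i.const_mul _).add (integrable_const _), ?_⟩
  rw [integral_add (i.const_mul _) (integrable_const _), integral_const_mul, h]
  simp only [integral_const, probReal_univ, smul_eq_mul]
  have : (v : ℝ) * (2 * b) ^ 2 / 2 = 2 * (v * b ^ 2) := by ring
  rw [this]; ring

/-- abstract iid lemma -/
lemma iid_bound {Ω : Type*} [MeasurableSpace Ω] (P : Measure Ω) [IsProbabilityMeasure P]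
    (m : ℕ) (hm : 2 ≤ m) (c : Fin m → Ω → ℝ) (hc : ∀ l, Measurable (c l))
    (hind : iIndepFun c P) (s : ℝ) (hs : 0 ≤ s)
    (h1 : ∀ l, ∫ ω, c l ω ∂P = 1) (h2i : ∀ l, MemLp (c l) 2 P)
    (h2 : ∀ l, ∫ ω, c l ω ^ 2 ∂P = (Real.exp s + Real.exp (-s)) / 2)
    (l : Fin m) (L' : Ω → ℝ) (hL : L' = fun ω => (1 / m : ℝ) * (∑ j ∈ Finset.univ.erase l, c j) ω)
    (K : ℝ) (hK : K = 2 * Real.exp (s / 2)) :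
    Integrable (fun ω => (c l ω ^ 2 - Real.exp (-s)) * (2 - L' ω + K * (1 - L' ω) ^ 2)) P ∧
    ∫ ω, (c l ω ^ 2 - Real.exp (-s)) * (2 - L' ω + K * (1 - L' ω) ^ 2) ∂P ≤
      1 / 2 * Real.exp s * (1 + (1 + 2 * Real.exp (3 / 2 * s)) / m) := by
  have hm0 : (0 : ℝ) < m := by exact_mod_cast (by omega : 0 < m)
  have hm1 : (1 : ℝ) ≤ m := by exact_mod_cast (by omega : 1 ≤ m)
  have hsumL : MemLp (∑ j ∈ Finset.univ.erase l, c j) 2 P := memLp_finsetSum' _ fun j _ => h2i j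
  have hL2 : MemLp L' 2 P := by rw [hL]; exact hsumL.const_mul _
  have hi : IndepFun (∑ j ∈ Finset.univ.erase l, c j) (c l) P :=
    hind.indepFun_finsetSum_of_notMem hc (by simp)
  have hcard : ((Finset.univ.erase l).card : ℝ) = m - 1 := by
    rw [Finset.card_erase_of_mem (Finset.mem_univ _)]
    simp only [Finset.card_univ, Fintype.card_fin]
    rw [Nat.cast_sub (by omega)]; simp
  have hEL : ∫ ω, L' ω ∂P = (m - 1) / m := by
    rw [hL, integral_const_mul]
    simp only [Finset.sum_apply]
    rw [integral_finsetSum _ fun j _ => (h2i j).integrable (by norm_num)]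
    simp only [h1, Finset.sum_const, nsmul_eq_mul, hcard]
    field_simp
  have hvc : ∀ j, variance (c j) P = (Real.exp s + Real.exp (-s)) / 2 - 1 := by
    intro j
    rw [variance_eq_sub (h2i j), h1 j]
    simp only [Pi.pow_apply]
    rw [h2 j]; ring
  have hvL : variance L' P = (m - 1) / m ^ 2 * ((Real.exp s + Real.exp (-s)) / 2 - 1) := by
    rw [hL, variance_const_mul, IndepFun.variance_sum (fun j _ => h2i j)
      (fun i _ j _ hij => hind.indepFun hij)]
    simp only [hvc, Finset.sum_const, nsmul_eq_mul, hcard]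
    ring
  have hL2i : Integrable (fun ω => L' ω ^ 2) P := hL2.integrable_sq
  have hLi : Integrable L' P := hL2.integrable (by norm_num)
  have hEL2 : ∫ ω, L' ω ^ 2 ∂P = (m - 1) / m ^ 2 * ((Real.exp s + Real.exp (-s)) / 2 - 1)
      + ((m - 1) / m) ^ 2 := by
    have := variance_eq_sub hL2
    rw [hvL, hEL] at this
    simp only [Pi.pow_apply] at this
    linarith
  have hge : (fun ω => 2 - L' ω + K * (1 - L' ω) ^ 2) =
      fun ω => K * L' ω ^ 2 - (1 + 2 * K) * L' ω + (2 + K) := by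
    ext ω; ring
  have i12 : Integrable (fun ω => K * L' ω ^ 2 - (1 + 2 * K) * L' ω) P :=
    (hL2i.const_mul K).sub (hLi.const_mul _)
  have hgi : Integrable (fun ω => 2 - L' ω + K * (1 - L' ω) ^ 2) P := by
    rw [hge]
    exact i12.add (integrable_const _)
  have hqi : Integrable (fun ω => c l ω ^ 2 - Real.exp (-s)) P :=
    ((h2i l).integrable_sq).sub (integrable_const _)
  have hEq : ∫ ω, (c l ω ^ 2 - Real.exp (-s)) ∂P = (Real.exp s - Real.exp (-s)) / 2 := by
    rw [integral_sub (h2i l).integrable_sq (integrable_const _), h2 l]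
    simp; ring
  have hEg : ∫ ω, (2 - L' ω + K * (1 - L' ω) ^ 2) ∂P ≤ 1 + (1 + 2 * Real.exp (3 / 2 * s)) / m := by
    rw [hge, integral_add i12 (integrable_const _), integral_sub (hL2i.const_mul K)
      (hLi.const_mul _), integral_const_mul, integral_const_mul, hEL, hEL2]
    simp only [integral_const, probReal_univ, smul_eq_mul]
    have e1 : Real.exp (s / 2) * Real.exp s = Real.exp (3 / 2 * s) := by
      rw [← Real.exp_add]; congr 1; ring
    have e2 : Real.exp (-s) ≤ Real.exp s := Real.exp_le_exp.2 (by linarith)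
    have e3 : K * ((m - 1) / m ^ 2 * ((Real.exp s + Real.exp (-s)) / 2 - 1)
      + ((m - 1) / m) ^ 2) - (1 + 2 * K) * ((m - 1) / m) + 1 * (2 + K) =
      1 + 1 / m + K * ((m - 1) / m ^ 2 * ((Real.exp s + Real.exp (-s)) / 2 - 1) + 1 / m ^ 2) := by
      field_simp; ring
    have e4 : (m - 1) / m ^ 2 * ((Real.exp s + Real.exp (-s)) / 2 - 1) + 1 / m ^ 2 ≤
        Real.exp s / m := by
      have h1e : 1 ≤ Real.exp s := Real.one_le_exp hs
      have : (m - 1) / m ^ 2 * ((Real.exp s + Real.exp (-s)) / 2 - 1) + 1 / m ^ 2 =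
        (((m : ℝ) - 1) * ((Real.exp s + Real.exp (-s)) / 2 - 1) + 1) / m ^ 2 := by field_simp
      rw [this, div_le_div_iff₀ (by positivity) hm0]
      have h3 : ((m : ℝ) - 1) * ((Real.exp s + Real.exp (-s)) / 2 - 1) ≤
          ((m : ℝ) - 1) * (Real.exp s - 1) :=
        mul_le_mul_of_nonneg_left (by linarith) (by linarith)
      have h4 : (((m : ℝ) - 1) * ((Real.exp s + Real.exp (-s)) / 2 - 1) + 1) ≤ Real.exp s * m := by
        nlinarith
      calc _ ≤ Real.exp s * m * m := by gcongr
        _ = _ := by ring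
    have e5 : K * ((m - 1) / m ^ 2 * ((Real.exp s + Real.exp (-s)) / 2 - 1) + 1 / m ^ 2) ≤
        K * (Real.exp s / m) := by
      apply mul_le_mul_of_nonneg_left e4; rw [hK]; positivity
    have e6 : K * (Real.exp s / m) = 2 * Real.exp (3 / 2 * s) / m := by
      rw [hK, ← e1]; ring
    have e7 := add_div 1 (2 * Real.exp (3 / 2 * s)) (m : ℝ)
    rw [e3]
    linarith
  have hg0 : 0 ≤ ∫ ω, (2 - L' ω + K * (1 - L' ω) ^ 2) ∂P := by
    apply integral_nonneg
    intro ω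
    have hK1 : 1 ≤ K := by
      rw [hK]; have := Real.one_le_exp (by linarith : 0 ≤ s / 2); linarith
    have := mul_le_mul_of_nonneg_right hK1 (sq_nonneg (1 - L' ω))
    simp only [Pi.zero_apply]
    nlinarith [sq_nonneg (1 - L' ω - 1 / 2), sq_nonneg (2 * (1 - L' ω) + 1)]
  have hind2 : IndepFun (fun ω => c l ω ^ 2 - Real.exp (-s))
      (fun ω => 2 - L' ω + K * (1 - L' ω) ^ 2) P := by
    have := hi.symm.comp (φ := fun x => x ^ 2 - Real.exp (-s))
      (ψ := fun x => 2 - (1 / m : ℝ) * x + K * (1 - (1 / m : ℝ) * x) ^ 2)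
      (by fun_prop) (by fun_prop)
    rw [hL]
    exact this
  refine ⟨hind2.integrable_mul hqi hgi, ?_⟩
  rw [hind2.integral_fun_mul_eq_mul_integral hqi.aestronglyMeasurable hgi.aestronglyMeasurable, hEq]
  have := Real.exp_pos (-s)
  calc (Real.exp s - Real.exp (-s)) / 2 * ∫ ω, (2 - L' ω + K * (1 - L' ω) ^ 2) ∂P
      ≤ (1 / 2 * Real.exp s) * ∫ ω, (2 - L' ω + K * (1 - L' ω) ^ 2) ∂P := by
        apply mul_le_mul_of_nonneg_right _ hg0; linarith
    _ ≤ _ := by gcongr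

instance gsm_prob (n : ℕ) (θ : Fin n → ℝ) (σ : ℝ) : IsProbabilityMeasure (gsm n θ σ) := by
  unfold gsm; infer_instance

lemma gauss_tilt (σ a : ℝ) (hσ : 0 < σ) :
    gaussianReal a ((σ ^ 2).toNNReal) = (gaussianReal 0 ((σ ^ 2).toNNReal)).withDensity
      (fun y => ENNReal.ofReal (Real.exp (a / σ ^ 2 * y - a ^ 2 / σ ^ 2 / 2))) := by
  have hv : (σ ^ 2).toNNReal ≠ 0 := by simp [hσ.ne']
  rw [gaussianReal_of_var_ne_zero _ hv, gaussianReal_of_var_ne_zero _ hv,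
    ← withDensity_mul _ (measurable_gaussianPDF _ _) (by fun_prop)]
  congr 1
  ext y
  simp only [Pi.mul_apply, gaussianPDF]
  rw [← ENNReal.ofReal_mul (gaussianPDFReal_nonneg _ _ _)]
  congr 1
  rw [gaussianPDFReal, gaussianPDFReal, mul_assoc _ (Real.exp _) (Real.exp _), ← Real.exp_add, Real.coe_toNNReal _ (sq_nonneg σ)]
  congr 2
  field_simp
  ring

lemma gsm_tilt (n : ℕ) (θ : Fin n → ℝ) (σ a : ℝ) (hσ : 0 < σ) (i : Fin n) (hi : θ i = 0) :
    gsm n (θ + Pi.single i a) σ = (gsm n θ σ).withDensity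
      (fun y => ENNReal.ofReal (Real.exp (a / σ ^ 2 * y i - a ^ 2 / σ ^ 2 / 2))) := by
  unfold gsm
  refine Measure.pi_eq fun S hS => ?_
  rw [withDensity_apply _ (MeasurableSet.univ_pi hS), Measure.restrict_pi_pi]
  set f : ℝ → ℝ≥0∞ := fun y => ENNReal.ofReal (Real.exp (a / σ ^ 2 * y - a ^ 2 / σ ^ 2 / 2)) with hf
  have hfm : Measurable f := by fun_prop
  have : ∫⁻ (y : Fin n → ℝ), ENNReal.ofReal (Real.exp (a / σ ^ 2 * y i - a ^ 2 / σ ^ 2 / 2))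
      ∂Measure.pi (fun j => (gaussianReal (θ j) ((σ ^ 2).toNNReal)).restrict (S j)) =
      ∫⁻ y, f y ∂((Measure.pi (fun j => (gaussianReal (θ j) ((σ ^ 2).toNNReal)).restrict (S j))).map
        (Function.eval i)) := by
    rw [lintegral_map hfm (measurable_pi_apply i)]
  rw [this, Measure.pi_map_eval, lintegral_smul_measure, ← withDensity_apply _ (hS i), hi,
    hf, ← gauss_tilt σ a hσ, ← Finset.prod_erase_mul _ _ (Finset.mem_univ i)]
  simp only [Pi.add_apply, Pi.single_eq_same, hi, zero_add, smul_eq_mul,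
    Measure.restrict_apply_univ]
  congr 1
  refine Finset.prod_congr rfl fun j hj => ?_
  rw [Pi.single_eq_of_ne (Finset.ne_of_mem_erase hj), add_zero]

/-- sign -/
def sg (x : Bool) : ℝ := if x then 1 else -1

lemma inv_le_quad (x L s K : ℝ) (hx : Real.exp (-(s / 2)) / 2 ≤ x) (hxL : x ≤ L)
    (hK : K = 2 * Real.exp (s / 2)) : 1 / L ≤ 2 - x + K * (1 - x) ^ 2 := by
  have hx0 : 0 < x := lt_of_lt_of_le (by positivity) hx
  have h1 : 1 / L ≤ 1 / x := one_div_le_one_div_of_le hx0 hxL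
  have h2 : 1 / x ≤ K := by
    rw [div_le_iff₀ hx0, hK]
    have : Real.exp (s / 2) * Real.exp (-(s / 2)) = 1 := by rw [← Real.exp_add]; simp
    have h3 := mul_le_mul_of_nonneg_left hx (Real.exp_pos (s / 2)).le
    linarith
  have h3 : 1 / x = 2 - x + 1 / x * (1 - x) ^ 2 := by field_simp; ring
  have h4 : 1 / x * (1 - x) ^ 2 ≤ K * (1 - x) ^ 2 := by gcongr
  linarith

lemma lint_ge {Ω : Type*} [MeasurableSpace Ω] (P : Measure Ω) (G D : Ω → ℝ)
    (hG : Integrable G P) (h : ∀ ω, G ω ≤ D ω) :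
    ENNReal.ofReal (∫ ω, G ω ∂P) ≤ ∫⁻ ω, ENNReal.ofReal (D ω) ∂P := by
  have h1 : ∫ ω, G ω ∂P ≤ ∫ ω, max (G ω) 0 ∂P :=
    integral_mono hG hG.pos_part fun ω => le_max_left _ _
  refine (ENNReal.ofReal_le_ofReal h1).trans ?_
  rw [ofReal_integral_eq_lintegral_ofReal hG.pos_part
    (Eventually.of_forall fun y => le_max_right _ _)]
  refine lintegral_mono fun ω => ?_
  rcases le_total (G ω) 0 with h0 | h0
  · simp [max_eq_right h0]
  · rw [max_eq_left h0]; exact ENNReal.ofReal_le_ofReal (h ω)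

/-- expansion over the prior -/
lemma prior_expand (m : ℕ) (τ : ℝ) (δ : Fin m → ℝ) (p : Fin m × Bool → ℝ) :
    ∑ x : Fin m × Bool, p x * ∑ l, (δ l - if l = x.1 then sg x.2 * τ else 0) ^ 2 =
      (∑ l, (p (l, true) + p (l, false))) * (∑ l, δ l ^ 2 + τ ^ 2)
        - 2 * τ * ∑ l, (p (l, true) - p (l, false)) * δ l := by
  have h1 : ∀ x : Fin m × Bool, ∑ l, (δ l - if l = x.1 then sg x.2 * τ else 0) ^ 2 =
      ∑ l, δ l ^ 2 - 2 * (sg x.2 * τ) * δ x.1 + τ ^ 2 := by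
    intro x
    have : ∀ l, (δ l - if l = x.1 then sg x.2 * τ else 0) ^ 2 =
        δ l ^ 2 + if l = x.1 then (τ ^ 2 - 2 * (sg x.2 * τ) * δ l) else 0 := by
      intro l
      have : sg x.2 ^ 2 = 1 := by unfold sg; split_ifs <;> norm_num
      split_ifs
      · linear_combination τ ^ 2 * this
      · ring
    simp_rw [this, Finset.sum_add_distrib]
    rw [Finset.sum_ite_eq' Finset.univ x.1]
    simp
    ring
  simp_rw [h1]
  rw [Fintype.sum_prod_type, Finset.sum_mul, Finset.mul_sum, ← Finset.sum_sub_distrib]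
  refine Finset.sum_congr rfl fun l _ => ?_
  simp [sg]
  ring

lemma block_bound (n m : ℕ) (hm : 2 ≤ m) (B : Fin m → Fin n) (hB : Function.Injective B)
    (θ : Fin n → ℝ) (hθ : ∀ l, θ (B l) = 0) (est : (Fin n → ℝ) → Fin n → ℝ) (hest : Measurable est)
    (τ σ s : ℝ) (hσ : 0 < σ) (hs : s = τ ^ 2 / σ ^ 2) :
    ENNReal.ofReal (2 * m * (τ ^ 2 * (1 - 1 / 2 * Real.exp s / m *
        (1 + (1 + 2 * Real.exp (3 / 2 * s)) / m)))) ≤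
      ∑ x : Fin m × Bool, ∫⁻ y, ENNReal.ofReal (∑ l, (est y (B l) -
        (θ + Pi.single (B x.1) (sg x.2 * τ) : Fin n → ℝ) (B l)) ^ 2)
          ∂(gsm n (θ + Pi.single (B x.1) (sg x.2 * τ)) σ) := by
  have hm0 : (0 : ℝ) < m := by exact_mod_cast (by omega : 0 < m)
  have hs0 : 0 ≤ s := by rw [hs]; positivity
  set P := gsm n θ σ with hP
  set b := τ / σ ^ 2 with hb
  set v := (σ ^ 2).toNNReal with hv
  have hvc : (v : ℝ) = σ ^ 2 := Real.coe_toNNReal _ (sq_nonneg σ)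
  have hvb : (v : ℝ) * b ^ 2 = s := by rw [hvc, hs, hb]; field_simp
  set c : Fin m → (Fin n → ℝ) → ℝ := fun l y => Real.exp (-(s / 2)) * Real.cosh (b * y (B l)) with hc
  have hcm : ∀ l, Measurable (c l) := fun l => by fun_prop
  have hind : iIndepFun c P := by
    have h1 : iIndepFun (fun (i : Fin n) (y : Fin n → ℝ) => Real.exp (-(s / 2)) * Real.cosh (b * y i)) P :=
      iIndepFun_pi (X := fun (_ : Fin n) (x : ℝ) => Real.exp (-(s / 2)) * Real.cosh (b * x))
        (fun i => by fun_prop)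
    exact h1.precomp hB
  have mp : ∀ l, MeasurePreserving (fun y : Fin n → ℝ => y (B l)) P (gaussianReal 0 v) := by
    intro l
    have := measurePreserving_eval (fun i => gaussianReal (θ i) v) (B l)
    rw [hθ l] at this
    exact this
  have hex : Real.exp (-(s / 2)) ^ 2 = Real.exp (-s) := by
    rw [← Real.exp_nat_mul]; congr 1; push_cast; ring
  have hci : ∀ l, Integrable (c l) P := fun l =>
    ((mp l).integrable_comp_of_integrable (cosh_int v b).1).const_mul _
  have h1 : ∀ l, ∫ y, c l y ∂P = 1 := by
    intro l
    rw [hc]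
    simp only
    rw [integral_const_mul]
    have := (mp l).hasLaw.integral_comp (f := fun x => Real.cosh (b * x)) (by fun_prop)
    simp only [Function.comp_def] at this
    rw [this, (cosh_int v b).2, hvb, ← Real.exp_add]
    simp
  have h2i : ∀ l, MemLp (c l) 2 P := by
    intro l
    refine (memLp_two_iff_integrable_sq (hcm l).aestronglyMeasurable).2 ?_
    have := ((mp l).integrable_comp_of_integrable (cosh_sq_int v b).1).const_mul
      (Real.exp (-(s / 2)) ^ 2)
    refine this.congr (Eventually.of_forall fun y => ?_)
    simp [hc, mul_pow]
  have h2 : ∀ l, ∫ y, c l y ^ 2 ∂P = (Real.exp s + Real.exp (-s)) / 2 := by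
    intro l
    simp only [hc, mul_pow]
    rw [integral_const_mul]
    have := (mp l).hasLaw.integral_comp (f := fun x => Real.cosh (b * x) ^ 2) (by fun_prop)
    simp only [Function.comp_def] at this
    rw [this, (cosh_sq_int v b).2, hvb, hex]
    have e : Real.exp (-s) * Real.exp (2 * s) = Real.exp s := by
      rw [← Real.exp_add]; congr 1; ring
    linear_combination 1 / 2 * e
  set K := 2 * Real.exp (s / 2) with hK
  set L' : Fin m → (Fin n → ℝ) → ℝ := fun l y =>
    (1 / m : ℝ) * (∑ j ∈ Finset.univ.erase l, c j) y with hL'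
  have hiid := fun l => iid_bound P m hm c hcm hind s hs0 h1 h2i h2 l (L' l) rfl K hK
  -- the lower function
  set G : (Fin n → ℝ) → ℝ := fun y => 2 * τ ^ 2 * ∑ l, c l y - 2 * τ ^ 2 / m *
    ∑ l, (c l y ^ 2 - Real.exp (-s)) * (2 - L' l y + K * (1 - L' l y) ^ 2) with hG
  have hG1 : Integrable (fun y => 2 * τ ^ 2 * ∑ l, c l y) P :=
    (integrable_finsetSum _ fun l _ => hci l).const_mul _
  have hG2 : Integrable (fun y => 2 * τ ^ 2 / m *
    ∑ l, (c l y ^ 2 - Real.exp (-s)) * (2 - L' l y + K * (1 - L' l y) ^ 2)) P :=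
    (integrable_finsetSum _ fun l _ => (hiid l).1).const_mul _
  have hGi : Integrable G P := hG1.sub hG2
  have hGint : 2 * m * (τ ^ 2 * (1 - 1 / 2 * Real.exp s / m *
        (1 + (1 + 2 * Real.exp (3 / 2 * s)) / m))) ≤ ∫ y, G y ∂P := by
    rw [hG, integral_sub hG1 hG2, integral_const_mul, integral_const_mul,
      integral_finsetSum _ fun l _ => hci l, integral_finsetSum _ fun l _ => (hiid l).1]
    simp only [h1, Finset.sum_const, Finset.card_univ, Fintype.card_fin, nsmul_eq_mul, mul_one]
    have := Finset.sum_le_sum fun l (_ : l ∈ Finset.univ) => (hiid l).2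
    simp only [Finset.sum_const, Finset.card_univ, Fintype.card_fin, nsmul_eq_mul] at this
    have h3 := mul_le_mul_of_nonneg_left this (by positivity : 0 ≤ 2 * τ ^ 2 / m)
    refine le_trans (le_of_eq ?_) (sub_le_sub_left h3 _)
    field_simp
  -- change of measure
  set p : (Fin n → ℝ) → Fin m × Bool → ℝ := fun y x =>
    Real.exp (sg x.2 * τ / σ ^ 2 * y (B x.1) - (sg x.2 * τ) ^ 2 / σ ^ 2 / 2) with hp
  set D : (Fin n → ℝ) → ℝ := fun y => ∑ x : Fin m × Bool,
    p y x * ∑ l, (est y (B l) - if l = x.1 then sg x.2 * τ else 0) ^ 2 with hD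
  have hrhs : (∑ x : Fin m × Bool, ∫⁻ y, ENNReal.ofReal (∑ l, (est y (B l) -
        (θ + Pi.single (B x.1) (sg x.2 * τ) : Fin n → ℝ) (B l)) ^ 2)
          ∂(gsm n (θ + Pi.single (B x.1) (sg x.2 * τ)) σ)) = ∫⁻ y, ENNReal.ofReal (D y) ∂P := by
    have hco : ∀ i, Measurable fun y => est y i := fun i => (measurable_pi_apply i).comp hest
    have : ∀ y, ENNReal.ofReal (D y) = ∑ x : Fin m × Bool, ENNReal.ofReal (p y x *
        ∑ l, (est y (B l) - if l = x.1 then sg x.2 * τ else 0) ^ 2) := fun y =>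
      ENNReal.ofReal_sum_of_nonneg fun x _ =>
        mul_nonneg (Real.exp_pos _).le (Finset.sum_nonneg fun l _ => sq_nonneg _)
    simp_rw [this]
    rw [lintegral_finsetSum]
    · refine Finset.sum_congr rfl fun x _ => ?_
      rw [gsm_tilt n θ σ _ hσ (B x.1) (hθ x.1), lintegral_withDensity_eq_lintegral_mul]
      · refine lintegral_congr fun y => ?_
        simp only [Pi.mul_apply]
        rw [← ENNReal.ofReal_mul (Real.exp_pos _).le]
        simp only [hp, Pi.add_apply, hθ, zero_add, Pi.single_apply, hB.eq_iff]
      · fun_prop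
      · have := fun l => hco (B l)
        fun_prop
    · intro x _
      have := fun l => hco (B l)
      fun_prop
  rw [hrhs]
  refine (ENNReal.ofReal_le_ofReal hGint).trans (lint_ge P G D hGi fun y => ?_)
  -- pointwise
  rw [hD]
  simp only
  rw [prior_expand]
  have ep : ∀ l, p y (l, true) = Real.exp (-(s / 2)) * Real.exp (b * y (B l)) := by
    intro l
    simp only [hp]
    rw [← Real.exp_add, hs, hb]; congr 1; simp [sg]; ring
  have em : ∀ l, p y (l, false) = Real.exp (-(s / 2)) * Real.exp (-(b * y (B l))) := by
    intro l
    simp only [hp]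
    rw [← Real.exp_add, hs, hb]; congr 1; simp [sg]; ring
  have hpp : ∀ l, p y (l, true) + p y (l, false) = 2 * c l y := by
    intro l
    rw [ep, em]
    simp only [hc]
    rw [Real.cosh_eq]; ring
  set S : Fin m → ℝ := fun l => Real.exp (-(s / 2)) * Real.sinh (b * y (B l)) with hS
  have hpm : ∀ l, p y (l, true) - p y (l, false) = 2 * S l := by
    intro l
    rw [ep, em]
    simp only [hS]
    rw [Real.sinh_eq]; ring
  simp_rw [hpp, hpm, ← Finset.mul_sum]
  have hclow : ∀ l, Real.exp (-(s / 2)) ≤ c l y := fun l =>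
    le_mul_of_one_le_right (Real.exp_pos _).le (Real.one_le_cosh _)
  have hcpos : ∀ l, 0 < c l y := fun l => lt_of_lt_of_le (Real.exp_pos _) (hclow l)
  set Λ := ∑ l, c l y with hΛ
  have hΛ0 : 0 < Λ := by
    apply Finset.sum_pos (fun l _ => hcpos l)
    exact ⟨⟨0, by omega⟩, Finset.mem_univ _⟩
  have hq : ∀ l, c l y ^ 2 - Real.exp (-s) = S l ^ 2 := by
    intro l
    simp only [hc, hS, mul_pow, Real.sinh_sq, ← hex]; ring
  have hinv : ∀ l, m / Λ ≤ 2 - L' l y + K * (1 - L' l y) ^ 2 := by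
    intro l
    have e : (m : ℝ) / Λ = 1 / (1 / m * Λ) := by field_simp
    rw [e]
    refine inv_le_quad _ _ s K ?_ ?_ hK
    · simp only [hL', Finset.sum_apply]
      have := Finset.card_nsmul_le_sum (Finset.univ.erase l) (fun j => c j y) _
        (fun j _ => hclow j)
      rw [Finset.card_erase_of_mem (Finset.mem_univ _), nsmul_eq_mul] at this
      simp only [Finset.card_univ, Fintype.card_fin] at this
      have h2m : (m : ℝ) / 2 ≤ ((m - 1 : ℕ) : ℝ) := by
        rw [Nat.cast_sub (by omega)]
        have : (2 : ℝ) ≤ m := by exact_mod_cast hm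
        push_cast; linarith
      calc Real.exp (-(s / 2)) / 2 = 1 / m * (m / 2 * Real.exp (-(s / 2))) := by field_simp
        _ ≤ 1 / m * (((m - 1 : ℕ) : ℝ) * Real.exp (-(s / 2))) := by gcongr
        _ ≤ _ := by gcongr
    · simp only [hL', Finset.sum_apply]
      gcongr
      rw [hΛ]
      exact Finset.sum_le_univ_sum_of_nonneg fun j => (hcpos j).le
  have hper : ∀ l, - (2 * τ ^ 2 / m * ((c l y ^ 2 - Real.exp (-s)) *
      (2 - L' l y + K * (1 - L' l y) ^ 2))) ≤
      2 * Λ * est y (B l) ^ 2 - 2 * τ * (2 * S l * est y (B l)) := by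
    intro l
    rw [hq]
    have h3 : 2 * τ ^ 2 / m * (S l ^ 2 * (m / Λ)) ≤ 2 * τ ^ 2 / m * (S l ^ 2 *
      (2 - L' l y + K * (1 - L' l y) ^ 2)) := by
      have := hinv l
      gcongr
    have h4 : 2 * Λ * est y (B l) ^ 2 - 2 * τ * (2 * S l * est y (B l)) +
        2 * τ ^ 2 / m * (S l ^ 2 * (m / Λ)) = 2 / Λ * (Λ * est y (B l) - τ * S l) ^ 2 := by
      field_simp; ring
    have h5 : 0 ≤ 2 / Λ * (Λ * est y (B l) - τ * S l) ^ 2 := by positivity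
    linarith
  have hsum := Finset.sum_le_sum fun l (_ : l ∈ Finset.univ) => hper l
  rw [Finset.sum_neg_distrib, ← Finset.mul_sum, Finset.sum_sub_distrib, ← Finset.mul_sum,
    ← Finset.mul_sum] at hsum
  simp only [hG]
  rw [← hΛ]
  linarith

lemma sum_update {k : ℕ} {X : Type*} [Fintype X] (j : Fin k) (F : (Fin k → X) → ℝ≥0∞) :
    ∑ ω : Fin k → X, ∑ x : X, F (Function.update ω j x) =
      (Fintype.card X : ℝ≥0∞) * ∑ ω, F ω := by
  have h1 : ∑ ω : Fin k → X, ∑ x : X, F (Function.update ω j x) =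
      ∑ z : (Fin k → X) × X, F (Function.update z.1 j z.2) := by
    rw [Fintype.sum_prod_type]
  have h2 : ∑ z : (Fin k → X) × X, F (Function.update z.1 j z.2) =
      ∑ z : (Fin k → X) × X, F z.1 := by
    let e : (Fin k → X) × X → (Fin k → X) × X := fun z => (Function.update z.1 j z.2, z.1 j)
    have he : Function.Involutive e := by
      intro z
      simp [e]
    exact Fintype.sum_equiv he.toPerm _ _ (fun z => rfl)
  rw [h1, h2, Fintype.sum_prod_type]
  simp [Finset.mul_sum]

lemma lower_bound (n k m : ℕ) (hm : 2 ≤ m) (hk : 1 ≤ k) (hkm : k * m ≤ n) (τ σ A s : ℝ)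
    (hτ : 0 < τ) (hσ : 0 < σ) (hA : 1 < A) (hs : s = τ ^ 2 / σ ^ 2) :
    ENNReal.ofReal (k * (τ ^ 2 * (1 - 1 / 2 * Real.exp s / m *
        (1 + (1 + 2 * Real.exp (3 / 2 * s)) / m)))) ≤
    minimaxRisk n σ (paramSetA n k τ A) := by
  set V := τ ^ 2 * (1 - 1 / 2 * Real.exp s / m *
        (1 + (1 + 2 * Real.exp (3 / 2 * s)) / m)) with hV
  unfold _root_.minimaxRisk
  refine le_iInf₂ fun est hest => ?_
  set R := ⨆ θ ∈ paramSetA n k τ A, risk n σ est θ with hR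
  -- block embedding
  let B : Fin k → Fin m → Fin n := fun j l => Fin.castLE hkm (finProdFinEquiv (j, l))
  have hB : ∀ j l j' l', B j l = B j' l' → j = j' ∧ l = l' := by
    intro j l j' l' h
    have := finProdFinEquiv.injective (Fin.castLE_injective hkm h)
    simpa using this
  let Θ : (Fin k → Fin m × Bool) → Fin n → ℝ := fun ω =>
    ∑ j, Pi.single (B j (ω j).1) (sg (ω j).2 * τ)
  have hsg : ∀ x, |sg x * τ| = τ := by
    intro x; unfold sg; split_ifs <;> simp [abs_of_pos hτ]
  have hzero : ∀ ω i, (∀ j, i ≠ B j (ω j).1) → Θ ω i = 0 := by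
    intro ω i h
    simp only [Θ, Finset.sum_apply]
    exact Finset.sum_eq_zero fun j _ => Pi.single_eq_of_ne (h j) _
  have hval : ∀ ω j, Θ ω (B j (ω j).1) = sg (ω j).2 * τ := by
    intro ω j
    simp only [Θ, Finset.sum_apply]
    rw [Finset.sum_eq_single j]
    · simp
    · intro j' _ hj'
      exact Pi.single_eq_of_ne (fun h => hj' (hB _ _ _ _ h).1.symm) _
    · simp
  have habs : ∀ ω i, |Θ ω i| ≤ τ := by
    intro ω i
    by_cases h : ∃ j, i = B j (ω j).1
    · obtain ⟨j, rfl⟩ := h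
      rw [hval, hsg]
    · push Not at h
      rw [hzero ω i h]; simpa using hτ.le
  have hmem : ∀ ω, Θ ω ∈ paramSetA n k τ A := by
    intro ω
    have hsub : Finset.univ.filter (fun i => Θ ω i ≠ 0) ⊆
        Finset.univ.image (fun j => B j (ω j).1) := by
      intro i hi
      simp only [Finset.mem_filter, Finset.mem_univ, true_and] at hi
      by_contra h
      apply hi
      apply hzero
      intro j hj
      exact h (by simp [hj])
    have hcard : (Finset.univ.filter (fun i => Θ ω i ≠ 0)).card ≤ k :=
      (Finset.card_le_card hsub).trans (Finset.card_image_le.trans (by simp))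
    refine ⟨?_, ?_, fun i => (habs ω i).trans (by nlinarith)⟩
    · rw [← Set.ncard_coe_finset] at hcard
      simpa using hcard
    · have h1 : ∀ i, Θ ω i ^ 2 ≤ if Θ ω i ≠ 0 then τ ^ 2 else 0 := by
        intro i
        split_ifs with h
        · exact sq_le_sq' (abs_le.1 (habs ω i)).1 (abs_le.1 (habs ω i)).2
        · push Not at h; simp [h]
      refine (Finset.sum_le_sum fun i _ => h1 i).trans ?_
      rw [← Finset.sum_filter, Finset.sum_const, nsmul_eq_mul]
      gcongr
  let F : Fin k → (Fin k → Fin m × Bool) → ℝ≥0∞ := fun j ω =>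
    ∫⁻ y, ENNReal.ofReal (∑ l, (est y (B j l) - Θ ω (B j l)) ^ 2) ∂(gsm n (Θ ω) σ)
  have hrisk : ∀ ω, ∑ j, F j ω ≤ R := by
    intro ω
    refine le_trans ?_ (le_iSup₂_of_le (Θ ω) (hmem ω) le_rfl)
    simp only [F, risk]
    have hco : ∀ i, Measurable fun y => est y i := fun i => (measurable_pi_apply i).comp hest
    rw [← lintegral_finsetSum]
    · refine lintegral_mono fun y => ?_
      simp only
      rw [← ENNReal.ofReal_sum_of_nonneg fun j _ => Finset.sum_nonneg fun l _ => sq_nonneg _]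
      apply ENNReal.ofReal_le_ofReal
      have : ∑ j, ∑ l, (est y (B j l) - Θ ω (B j l)) ^ 2 =
          ∑ x : Fin k × Fin m, (est y (B x.1 x.2) - Θ ω (B x.1 x.2)) ^ 2 := by
        rw [Fintype.sum_prod_type]
      rw [this]
      have hinj : Function.Injective fun x : Fin k × Fin m => B x.1 x.2 := by
        intro x x' h
        have := hB _ _ _ _ h
        exact Prod.ext this.1 this.2
      have := Finset.sum_image (s := Finset.univ) (g := fun x : Fin k × Fin m => B x.1 x.2)
        (f := fun i => (est y i - Θ ω i) ^ 2) hinj.injOn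
      rw [← this]
      exact Finset.sum_le_univ_sum_of_nonneg fun i => sq_nonneg _
    · intro j _
      have := fun l => hco (B j l)
      fun_prop
  have hblock : ∀ j ω, ENNReal.ofReal (2 * m * V) ≤ ∑ x, F j (Function.update ω j x) := by
    intro j ω
    let θ0 : Fin n → ℝ := ∑ j' ∈ Finset.univ.erase j, Pi.single (B j' (ω j').1) (sg (ω j').2 * τ)
    have h0 : ∀ l, θ0 (B j l) = 0 := by
      intro l
      simp only [θ0, Finset.sum_apply]
      refine Finset.sum_eq_zero fun j' hj' => Pi.single_eq_of_ne (fun h => ?_) _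
      exact Finset.ne_of_mem_erase hj' (hB _ _ _ _ h).1.symm
    have hΘ : ∀ x, Θ (Function.update ω j x) = θ0 + Pi.single (B j x.1) (sg x.2 * τ) := by
      intro x
      simp only [Θ, θ0]
      rw [← Finset.sum_erase_add _ _ (Finset.mem_univ j)]
      congr 1
      · refine Finset.sum_congr rfl fun j' hj' => ?_
        rw [Function.update_of_ne (Finset.ne_of_mem_erase hj')]
      · simp
    have := block_bound n m hm (B j) (fun l l' h => (hB _ _ _ _ h).2) θ0 h0 est hest τ σ s hσ hs
    refine this.trans (le_of_eq ?_)
    refine Finset.sum_congr rfl fun x _ => ?_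
    simp only [F, hΘ]
  set N : ℝ≥0∞ := (Fintype.card (Fin k → Fin m × Bool) : ℝ≥0∞) with hN
  have : Nonempty (Fin m) := ⟨⟨0, by omega⟩⟩
  have hN0 : N ≠ 0 := by rw [hN]; exact_mod_cast Fintype.card_ne_zero
  have hNt : N ≠ ⊤ := by rw [hN]; exact ENNReal.natCast_ne_top _
  have hFj : ∀ j, N * ENNReal.ofReal V ≤ ∑ ω, F j ω := by
    intro j
    have h1 := Finset.sum_le_sum fun ω (_ : ω ∈ Finset.univ) => hblock j ω
    rw [sum_update, Finset.sum_const, nsmul_eq_mul, Finset.card_univ, ← hN] at h1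
    have h2 : ((Fintype.card (Fin m × Bool) : ℕ) : ℝ≥0∞) = ENNReal.ofReal (2 * m) := by
      rw [Fintype.card_prod, Fintype.card_fin, Fintype.card_bool, ← ENNReal.ofReal_natCast]
      congr 1; push_cast; ring
    rw [h2, ENNReal.ofReal_mul (by positivity), mul_left_comm] at h1
    have hm0 : (0 : ℝ) < m := by exact_mod_cast (by omega : 0 < m)
    exact (ENNReal.mul_le_mul_iff_right (ENNReal.ofReal_pos.2 (by positivity)).ne' ENNReal.ofReal_ne_top).1 h1
  have hfin : N * (k * ENNReal.ofReal V) ≤ N * R := by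
    calc N * (k * ENNReal.ofReal V) = ∑ j : Fin k, N * ENNReal.ofReal V := by
          simp; ring
      _ ≤ ∑ j, ∑ ω, F j ω := Finset.sum_le_sum fun j _ => hFj j
      _ = ∑ ω, ∑ j, F j ω := Finset.sum_comm
      _ ≤ ∑ ω : Fin k → Fin m × Bool, R := Finset.sum_le_sum fun ω _ => hrisk ω
      _ = N * R := by rw [Finset.sum_const, nsmul_eq_mul, Finset.card_univ]
  have := (ENNReal.mul_le_mul_iff_right hN0 hNt).1 hfin
  rw [ENNReal.ofReal_mul (by positivity), ENNReal.ofReal_natCast]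
  exact this

lemma exp_small (ε μ : ℕ → ℝ) (hpos : ∀ᶠ n in atTop, 0 < ε n)
    (hε0 : Tendsto ε atTop (𝓝 0))
    (hμo : Tendsto (fun n => μ n / Real.sqrt (Real.log (ε n)⁻¹)) atTop (𝓝 0)) (C : ℝ) :
    Tendsto (fun n => ε n * Real.exp (C * μ n ^ 2)) atTop (𝓝 0) := by
  have h1 : Tendsto (fun n => C * (μ n / Real.sqrt (Real.log (ε n)⁻¹)) ^ 2) atTop (𝓝 0) := by
    have := (hμo.pow 2).const_mul C
    rwa [show C * (0 : ℝ) ^ 2 = 0 by ring] at this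
  have h2 : Tendsto (fun n => Real.sqrt (ε n)) atTop (𝓝 0) := by
    have := (Real.continuous_sqrt.tendsto 0).comp hε0
    rw [Real.sqrt_zero] at this
    exact this
  refine squeeze_zero' ?_ ?_ h2
  · filter_upwards [hpos] with n hn
    positivity
  · filter_upwards [hpos, hε0.eventually (gt_mem_nhds (by norm_num : (0:ℝ) < 1)),
      h1.eventually (gt_mem_nhds (by norm_num : (0:ℝ) < 1 / 2))] with n hn hn1 hn2
    have hlog : 0 < Real.log (ε n)⁻¹ := Real.log_pos ((one_lt_inv₀ hn).2 hn1)
    rw [div_pow, Real.sq_sqrt hlog.le, ← mul_div_assoc, div_lt_iff₀ hlog, Real.log_inv] at hn2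
    have h3 : Real.exp (C * μ n ^ 2) ≤ Real.exp (-(1 / 2 * Real.log (ε n))) :=
      Real.exp_le_exp.2 (by linarith)
    have h4 : Real.sqrt (ε n) = Real.exp (1 / 2 * Real.log (ε n)) := by
      rw [Real.sqrt_eq_iff_mul_self_eq hn.le (Real.exp_pos _).le, ← Real.exp_add]
      rw [← add_mul]; norm_num [Real.exp_log hn]
    rw [h4]
    calc ε n * Real.exp (C * μ n ^ 2) ≤ Real.exp (Real.log (ε n)) * Real.exp (-(1 / 2 * Real.log (ε n))) := by
          rw [Real.exp_log hn]; gcongr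
      _ = _ := by rw [← Real.exp_add]; congr 1; ring

/-- Theorem `thm::regime_2_compactness`. -/
theorem statement4
    (k : ℕ → ℕ) (τ σ ε μ : ℕ → ℝ)
    (hk : ∀ n, 1 ≤ n → 1 ≤ k n ∧ k n ≤ n)
    (hτ : ∀ n, 0 < τ n) (hσ : ∀ n, 0 < σ n)
    (hε : ∀ n, ε n = (k n : ℝ) / n) (hμ : ∀ n, μ n = τ n / σ n)
    (hε0 : Tendsto ε atTop (𝓝 0)) (hμtop : Tendsto μ atTop atTop)
    (hμo : Tendsto (fun n => μ n / Real.sqrt (Real.log (ε n)⁻¹)) atTop (𝓝 0))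
    (A : ℝ) (hA : 1 < A) :
    ∃ c : ℕ → ℝ, Tendsto c atTop (𝓝 1) ∧
      ∀ᶠ n : ℕ in atTop,
        minimaxRisk n (σ n) (paramSetA n (k n) (τ n) A) =
          ENNReal.ofReal ((n : ℝ) * σ n ^ 2 *
            (ε n * μ n ^ 2 - 1 / 2 * ε n ^ 2 * μ n ^ 2 * Real.exp (μ n ^ 2) * c n)) := by
  have hpos : ∀ᶠ n in atTop, 0 < ε n := by
    filter_upwards [eventually_ge_atTop 1] with n hn
    rw [hε n]
    have h1 : (0 : ℝ) < k n := by exact_mod_cast (hk n hn).1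
    have h2 : (0 : ℝ) < n := by exact_mod_cast hn
    positivity
  have hsm := exp_small ε μ hpos hε0 hμo
  have hs2 : Tendsto (fun n => μ n ^ 2) atTop atTop := (tendsto_pow_atTop (by norm_num)).comp hμtop
  set R : ℕ → ℝ≥0∞ := fun n => minimaxRisk n (σ n) (paramSetA n (k n) (τ n) A) with hR
  set c : ℕ → ℝ := fun n => (ε n * μ n ^ 2 - (R n).toReal / (n * σ n ^ 2)) /
    (1 / 2 * ε n ^ 2 * μ n ^ 2 * Real.exp (μ n ^ 2)) with hc
  set lo : ℕ → ℝ := fun n => 1 - 2 * A * Real.exp (-(μ n ^ 2)) - ε n * Real.exp (2 * A * μ n ^ 2)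
    with hlo
  set hi : ℕ → ℝ := fun n => 1 / (1 - ε n) * (1 + (ε n + 2 * (ε n * Real.exp (3 / 2 * μ n ^ 2))) /
    (1 - ε n)) with hhi
  have hlot : Tendsto lo atTop (𝓝 1) := by
    have h1 : Tendsto (fun n => Real.exp (-(μ n ^ 2))) atTop (𝓝 0) :=
      Real.tendsto_exp_neg_atTop_nhds_zero.comp hs2
    have := ((tendsto_const_nhds (x := (1 : ℝ))).sub (h1.const_mul (2 * A))).sub (hsm (2 * A))
    simpa using this
  have hhit : Tendsto hi atTop (𝓝 1) := by
    have h1 : Tendsto (fun n => 1 - ε n) atTop (𝓝 1) := by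
      simpa using (tendsto_const_nhds (x := (1 : ℝ))).sub hε0
    have h2 := (hε0.add ((hsm (3 / 2)).const_mul 2)).div h1 one_ne_zero
    have h3 := ((tendsto_const_nhds (x := (1 : ℝ))).div h1 one_ne_zero).mul
      ((tendsto_const_nhds (x := (1 : ℝ))).add h2)
    rw [show (1:ℝ)/1*(1+(0+2*0)/1) = 1 by norm_num] at h3
    exact h3
  have hmain : ∀ᶠ n : ℕ in atTop, R n ≠ ⊤ ∧ lo n ≤ c n ∧ c n ≤ hi n ∧ 0 < n ∧ 0 < ε n ∧
      0 < μ n := by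
    filter_upwards [eventually_ge_atTop 1, hpos, hε0.eventually (gt_mem_nhds
      (by norm_num : (0 : ℝ) < 1 / 2)), hs2.eventually_ge_atTop 1, hμtop.eventually_gt_atTop 0,
      (hsm 2).eventually (gt_mem_nhds (by norm_num : (0 : ℝ) < 1))] with n hn1 hε1 hε2 hs1 hμ1 hq
    set s := μ n ^ 2 with hs
    have hτn := hτ n
    have hσn := hσ n
    obtain ⟨hk1, hk2⟩ := hk n hn1
    have hn0 : (0 : ℝ) < n := by exact_mod_cast hn1
    have hk0 : (0 : ℝ) < k n := by exact_mod_cast hk1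
    have hsτ : s = τ n ^ 2 / σ n ^ 2 := by rw [hs, hμ n, div_pow]
    have hq2 : ε n * (s + 1) * Real.exp s ≤ 2 := by
      have h1 : s + 1 ≤ Real.exp s := Real.add_one_le_exp s
      have h2 : Real.exp (2 * s) = Real.exp s * Real.exp s := by
        rw [← Real.exp_add]; congr 1; ring
      rw [h2] at hq
      calc ε n * (s + 1) * Real.exp s ≤ ε n * Real.exp s * Real.exp s := by gcongr
        _ ≤ 2 := by linarith
    have hup := upper_bound n (k n) (τ n) (σ n) A hk1 hk2 hτn hσn hA s (ε n) hsτ (hε n) hs1 hq2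
    have hdiv : k n * (n / k n) ≤ n := Nat.mul_div_le n (k n)
    have hlt : n < k n * (n / k n + 1) := Nat.lt_mul_div_succ n hk1
    have hkn2 : 2 * k n ≤ n := by
      rw [hε n, div_lt_iff₀ hn0] at hε2
      have : (2 * k n : ℝ) ≤ n := by linarith
      exact_mod_cast this
    have hm2 : 2 ≤ n / k n := (Nat.le_div_iff_mul_le hk1).2 hkn2
    set m := n / k n with hm
    have hlow := lower_bound n (k n) m hm2 hk1 hdiv (τ n) (σ n) A s hτn hσn hA hsτ
    have hm0 : (0 : ℝ) < m := by exact_mod_cast (by omega : 0 < m)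
    have h1ε : 0 < 1 - ε n := by linarith
    have hminv : 1 / (m : ℝ) ≤ ε n / (1 - ε n) := by
      rw [div_le_div_iff₀ hm0 h1ε]
      have h1 : (n : ℝ) < k n * (m + 1) := by exact_mod_cast hlt
      have h2 : 1 < ε n * (m + 1) := by
        rw [hε n, div_mul_eq_mul_div, lt_div_iff₀ hn0]; linarith
      linarith
    have hRt : R n ≠ ⊤ := ne_top_of_le_ne_top ENNReal.ofReal_ne_top hup
    have hE : 0 < Real.exp s := Real.exp_pos s
    have hs0 : 0 < s := by linarith
    have hkε : (k n : ℝ) = n * ε n := by rw [hε n]; field_simp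
    have hτs : τ n ^ 2 = σ n ^ 2 * s := by rw [hsτ]; field_simp
    have hR0 : (R n).toReal = n * σ n ^ 2 * ε n * s * (1 - 1 / 2 * ε n * Real.exp s * c n) := by
      simp only [hc]
      field_simp
      ring
    have hW : 0 < n * σ n ^ 2 * ε n * s := by positivity
    have hkτ : k n * τ n ^ 2 = n * σ n ^ 2 * ε n * s := by rw [hkε, hτs]; ring
    have hq0 : 0 < 1 / 2 * ε n * Real.exp s := by positivity
    refine ⟨hRt, ?_, ?_, by omega, hε1, hμ1⟩
    · -- upper bound on the risk
      have hlo1 : lo n ≤ 1 := by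
        simp only [hlo]
        have : 0 < 2 * A * Real.exp (-(μ n ^ 2)) := by positivity
        have : 0 < ε n * Real.exp (2 * A * μ n ^ 2) := by positivity
        linarith
      have hq3 : 1 / 2 * ε n * Real.exp s ≤ 1 := by
        have : ε n * 1 * Real.exp s ≤ ε n * (s + 1) * Real.exp s := by gcongr; linarith
        linarith
      have hnn : 0 ≤ 1 - 1 / 2 * ε n * Real.exp s * lo n := by
        have := mul_le_mul_of_nonneg_left hlo1 hq0.le
        linarith
      have h1 : (R n).toReal ≤ n * σ n ^ 2 * ε n * s * (1 - 1 / 2 * ε n * Real.exp s * lo n) := by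
        apply ENNReal.toReal_le_of_le_ofReal (by positivity)
        rw [← hkτ]
        exact hup
      rw [hR0] at h1
      have h2 := le_of_mul_le_mul_left h1 hW
      have h3 : 1 / 2 * ε n * Real.exp s * lo n ≤ 1 / 2 * ε n * Real.exp s * c n := by linarith
      exact le_of_mul_le_mul_left h3 hq0
    · have h1 := (ENNReal.ofReal_le_iff_le_toReal hRt).1 hlow
      rw [hR0, ← mul_assoc, hkτ] at h1
      have h2 := le_of_mul_le_mul_left h1 hW
      have h3 : 1 / 2 * Real.exp s / m * (1 + (1 + 2 * Real.exp (3 / 2 * s)) / m) ≤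
          1 / 2 * ε n * Real.exp s * hi n := by
        calc 1 / 2 * Real.exp s / m * (1 + (1 + 2 * Real.exp (3 / 2 * s)) / m)
            = 1 / 2 * Real.exp s * (1 / m) * (1 + (1 + 2 * Real.exp (3 / 2 * s)) * (1 / m)) := by
              ring
          _ ≤ 1 / 2 * Real.exp s * (ε n / (1 - ε n)) *
              (1 + (1 + 2 * Real.exp (3 / 2 * s)) * (ε n / (1 - ε n))) := by gcongr
          _ = _ := by simp only [hhi, ← hs]; ring
      have h4 : 1 / 2 * ε n * Real.exp s * c n ≤ 1 / 2 * ε n * Real.exp s * hi n := by linarith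
      exact le_of_mul_le_mul_left h4 hq0
  refine ⟨c, tendsto_of_tendsto_of_tendsto_of_le_of_le' hlot hhit
    (hmain.mono fun n h => h.2.1) (hmain.mono fun n h => h.2.2.1), ?_⟩
  filter_upwards [hmain] with n hh
  obtain ⟨hRt, -, -, hn, hε1, hμ1⟩ := hh
  have hn0 : (0 : ℝ) < n := by exact_mod_cast hn
  have hσn := hσ n
  have hE : 0 < Real.exp (μ n ^ 2) := Real.exp_pos _
  have : (n : ℝ) * σ n ^ 2 *
            (ε n * μ n ^ 2 - 1 / 2 * ε n ^ 2 * μ n ^ 2 * Real.exp (μ n ^ 2) * c n) =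
      (R n).toReal := by
    simp only [hc]
    field_simp
    ring
  rw [this, ENNReal.ofReal_toReal hRt]
end
end

section
/- Consider the Gaussian sequence model with noise level σₙ and the SNR-aware parameter space Θ(kₙ, τₙ). Suppose εₙ = kₙ/n → 0, μₙ = τₙ/σₙ → ∞ and μₙ = o(√(log εₙ⁻¹)) as n → ∞. Then the optimally tuned soft thresholding estimator has supremum risk: inf over λ ≥ 0 of sup over θ ∈ Θ(kₙ,τₙ) of E_θ‖η̂_S(y,λ) − θ‖₂² = n σₙ² ( εₙ μₙ² − exp[ −(1/2)(1/μₙ²)(log(1/εₙ))² (1+o(1)) ] ). -/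
open MeasureTheory ProbabilityTheory Filter
open scoped ENNReal NNReal Topology

noncomputable section

/-- Soft thresholding estimator `[η̂_S(y,λ)]ᵢ = sign(yᵢ)(|yᵢ|−λ)₊`. -/
def softEst (n : ℕ) (lam : ℝ) : (Fin n → ℝ) → Fin n → ℝ :=
  fun y i => Real.sign (y i) * max (|y i| - lam) 0

def xClamp (lam y : ℝ) : ℝ := max (-lam) (min lam y)

def xr (lam t : ℝ) : ℝ := ∫ z, (z - xClamp lam (t + z)) ^ 2 ∂(gaussianReal 0 1)

lemma xClamp_meas (lam : ℝ) : Measurable (xClamp lam) := by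
  unfold xClamp; fun_prop

lemma xClamp_abs {lam : ℝ} (h : 0 ≤ lam) (y : ℝ) : |xClamp lam y| ≤ lam := by
  unfold xClamp
  rw [abs_le]
  refine ⟨le_max_left _ _, max_le (by linarith) (min_le_left _ _)⟩

lemma xClamp_lip (lam x y : ℝ) : |xClamp lam x - xClamp lam y| ≤ |x - y| := by
  unfold xClamp
  refine (abs_max_sub_max_le_max _ _ _ _).trans ?_
  simp only [sub_self, abs_zero]
  refine max_le (abs_nonneg _) ?_
  refine (abs_min_sub_min_le_max _ _ _ _).trans ?_
  simp

lemma xsoft {lam : ℝ} (h : 0 ≤ lam) (y : ℝ) :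
    Real.sign y * max (|y| - lam) 0 = y - xClamp lam y := by
  unfold xClamp
  rcases lt_trichotomy y 0 with hy | hy | hy
  · rw [Real.sign_of_neg hy, abs_of_neg hy, min_eq_right (by linarith)]
    rcases le_total (-lam) y with h1 | h1
    · rw [max_eq_right h1, max_eq_right (by linarith)]; ring
    · rw [max_eq_left h1, max_eq_left (by linarith)]; ring
  · subst hy
    simp [h]
  · rw [Real.sign_of_pos hy, abs_of_pos hy]
    rcases le_total lam y with h1 | h1
    · rw [min_eq_left h1, max_eq_right (by linarith : -lam ≤ lam), max_eq_left (by linarith)]; ring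
    · rw [min_eq_right h1, max_eq_right (by linarith), max_eq_right (by linarith)]; ring

lemma xint_sq : Integrable (fun z : ℝ => z ^ 2) (gaussianReal 0 1) := by
  have := (memLp_id_gaussianReal (μ := 0) (v := 1) 2).integrable_sq
  simpa using this

lemma xint_id : Integrable (fun z : ℝ => z) (gaussianReal 0 1) := by
  have := (memLp_id_gaussianReal (μ := 0) (v := 1) 1).integrable (by simp)
  exact this

lemma xr_integrable {lam : ℝ} (h : 0 ≤ lam) (t : ℝ) :
    Integrable (fun z => (z - xClamp lam (t + z)) ^ 2) (gaussianReal 0 1) := by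
  refine Integrable.mono' ((xint_sq.const_mul 2).add (integrable_const (2 * lam ^ 2))) ?_ ?_
  · have := xClamp_meas lam
    exact (by fun_prop : Measurable _).aestronglyMeasurable
  · refine ae_of_all _ fun z => ?_
    have h1 := xClamp_abs h (t + z)
    have h2 : xClamp lam (t + z) ^ 2 ≤ lam ^ 2 := by
      rw [← sq_abs]; exact pow_le_pow_left₀ (abs_nonneg _) h1 2
    rw [Real.norm_of_nonneg (sq_nonneg _)]
    simp only [Pi.add_apply]
    nlinarith [sq_nonneg (z + xClamp lam (t + z))]

lemma xClamp_scale {lam s : ℝ} (hs : 0 < s) (y : ℝ) :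
    xClamp lam (s * y) = s * xClamp (lam / s) y := by
  unfold xClamp
  rw [mul_max_of_nonneg _ _ hs.le, mul_min_of_nonneg _ _ hs.le]
  congr 1
  · field_simp
  · congr 1; field_simp

lemma xcoord {lam s : ℝ} (hs : 0 < s) (hl : 0 ≤ lam) (t : ℝ) :
    ∫⁻ y, ENNReal.ofReal ((Real.sign y * max (|y| - lam) 0 - t) ^ 2)
      ∂(gaussianReal t ((s ^ 2).toNNReal)) = ENNReal.ofReal (s ^ 2 * xr (lam / s) (t / s)) := by
  have hm : gaussianReal t ((s ^ 2).toNNReal)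
      = (gaussianReal 0 1).map (fun z => t + s * z) := by
    have h1 := gaussianReal_map_const_mul (μ := 0) (v := 1) s
    have h2 := gaussianReal_map_const_add (μ := s * 0) (v := NNReal.mk (s ^ 2) (sq_nonneg s) * 1) t
    rw [← h1, Measure.map_map (by fun_prop) (by fun_prop)] at h2
    have h3 : (fun x => t + x) ∘ (fun x => s * x) = fun z => t + s * z := rfl
    rw [h3] at h2
    rw [h2]
    congr 1
    · simp
    · rw [mul_one]; ext; simp [sq_nonneg]
  have hc := xClamp_meas lam
  have hl' : 0 ≤ lam / s := by positivity
  simp_rw [xsoft hl]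
  rw [hm, lintegral_map (by fun_prop) (by fun_prop)]
  have : ∀ z, (t + s * z - xClamp lam (t + s * z) - t) ^ 2
      = s ^ 2 * (z - xClamp (lam / s) (t / s + z)) ^ 2 := by
    intro z
    have : t + s * z = s * (t / s + z) := by field_simp
    rw [this, xClamp_scale hs]
    field_simp
    ring
  simp_rw [this]
  rw [← ofReal_integral_eq_lintegral_ofReal]
  · rw [integral_const_mul]; rfl
  · exact (xr_integrable hl' _).const_mul _
  · exact ae_of_all _ fun _ => by positivity

lemma xr_nonneg (lam t : ℝ) : 0 ≤ xr lam t := integral_nonneg fun _ => sq_nonneg _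

lemma xrisk (n : ℕ) {lam s : ℝ} (hs : 0 < s) (hl : 0 ≤ lam) (θ : Fin n → ℝ) :
    risk n s (softEst n lam) θ = ENNReal.ofReal (s ^ 2 * ∑ i, xr (lam / s) (θ i / s)) := by
  unfold risk gsm softEst
  have hc := xClamp_meas lam
  simp_rw [ENNReal.ofReal_sum_of_nonneg (fun i _ => sq_nonneg _)]
  rw [lintegral_finsetSum']
  · rw [Finset.mul_sum, ENNReal.ofReal_sum_of_nonneg]
    · refine Finset.sum_congr rfl fun i _ => ?_
      rw [← xcoord hs hl, ← (measurePreserving_eval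
        (fun i => gaussianReal (θ i) ((s ^ 2).toNNReal)) i).map_eq, lintegral_map]
      · simp_rw [xsoft hl]; fun_prop
      · fun_prop
    · intro i _
      have := xr_nonneg (lam / s) (θ i / s)
      positivity
  · intro i _
    simp_rw [xsoft hl]; fun_prop

lemma xr_neg (lam t : ℝ) (h : 0 ≤ lam) : xr lam (-t) = xr lam t := by
  have hc := xClamp_meas lam
  unfold xr
  have h1 := gaussianReal_map_neg (μ := 0) (v := 1)
  rw [neg_zero] at h1
  conv_lhs => rw [← h1]
  rw [integral_map (by fun_prop) (by exact (by fun_prop : Measurable _).aestronglyMeasurable)]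
  refine integral_congr_ae (ae_of_all _ fun z => ?_)
  have : xClamp lam (-t + -z) = - xClamp lam (t + z) := by
    unfold xClamp
    rw [← neg_add]
    have h0 : -lam ≤ lam := by linarith
    rcases le_total lam (t + z) with h1 | h1 <;> rcases le_total (-lam) (t + z) with h2 | h2 <;>
    rcases le_total lam (-(t + z)) with h3 | h3 <;> rcases le_total (-lam) (-(t + z)) with h4 | h4 <;>
    simp only [min_eq_left, min_eq_right, max_eq_left, max_eq_right, h0, h1, h2, h3, h4] <;>
    linarith
  simp only [this]
  ring

def xp (lam t : ℝ) : ℝ := (gaussianReal 0 1).real (Set.Ioo (-lam - t) (lam - t))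

lemma xr_deriv {lam : ℝ} (h : 0 ≤ lam) (t : ℝ) : HasDerivAt (xr lam) (xp lam t * (2 * t)) t := by
  have hc := xClamp_meas lam
  have key := hasDerivAt_integral_of_dominated_loc_of_lip (𝕜 := ℝ) (μ := gaussianReal 0 1)
    (F := fun t z => (z - xClamp lam (t + z)) ^ 2) (s := Set.univ) (x₀ := t)
    (F' := (Set.Ioo (-lam - t) (lam - t)).indicator (fun _ => 2 * t))
    (bound := fun z => 2 * |z| + 2 * lam) Filter.univ_mem
    (Filter.Eventually.of_forall fun x => (by fun_prop : Measurable _).aestronglyMeasurable)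
    (xr_integrable h t)
    ((measurable_const.indicator measurableSet_Ioo).aestronglyMeasurable)
    ?_ ((xint_id.abs.const_mul 2).add (integrable_const _)) ?_
  · have h2 := key.2
    rw [integral_indicator_const _ measurableSet_Ioo] at h2
    exact h2
  · refine ae_of_all _ fun z => ?_
    refine LipschitzOnWith.of_dist_le_mul fun x _ y _ => ?_
    rw [Real.dist_eq, Real.dist_eq, Real.coe_nnabs]
    rw [abs_of_nonneg (by positivity : 0 ≤ 2 * |z| + 2 * lam)]
    have e : (z - xClamp lam (x + z)) ^ 2 - (z - xClamp lam (y + z)) ^ 2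
      = (2 * z - xClamp lam (x + z) - xClamp lam (y + z)) *
        -(xClamp lam (x + z) - xClamp lam (y + z)) := by ring
    rw [e, abs_mul, abs_neg]
    have h1 := xClamp_abs h (x + z)
    have h2 := xClamp_abs h (y + z)
    have h3 := xClamp_lip lam (x + z) (y + z)
    rw [add_sub_add_right_eq_sub] at h3
    refine mul_le_mul ?_ h3 (abs_nonneg _) (by positivity)
    calc _ ≤ |2 * z - xClamp lam (x + z)| + |xClamp lam (y + z)| := abs_sub _ _
      _ ≤ |2 * z| + |xClamp lam (x + z)| + |xClamp lam (y + z)| := by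
        gcongr; exact abs_sub _ _
      _ ≤ _ := by rw [abs_mul, abs_two]; linarith
  · have hn : ∀ a : ℝ, ∀ᵐ z ∂(gaussianReal 0 1), z ≠ a := by
      intro a
      have := nullSingletonClass_gaussianReal (μ := 0) (v := 1) one_ne_zero
      exact compl_mem_ae_iff.mpr (measure_singleton a)
    filter_upwards [hn (-lam - t), hn (lam - t)] with z h1 h2
    rcases lt_or_gt_of_ne h1 with h1 | h1
    · rw [Set.indicator_of_notMem (by simp; intro h; linarith)]
      refine (hasDerivAt_const t ((z + lam) ^ 2)).congr_of_eventuallyEq ?_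
      have : ∀ᶠ x in 𝓝 t, x < -lam - z := eventually_lt_nhds (by linarith)
      filter_upwards [this] with x hx
      unfold xClamp
      rw [max_eq_left ((min_le_right _ _).trans (by linarith))]; ring
    · rcases lt_or_gt_of_ne h2 with h2 | h2
      · rw [Set.indicator_of_mem (Set.mem_Ioo.2 ⟨h1, h2⟩)]
        have hd : HasDerivAt (fun x : ℝ => x ^ 2) (2 * t) t := by
          simpa using hasDerivAt_pow 2 t
        refine hd.congr_of_eventuallyEq ?_
        have a1 : ∀ᶠ x in 𝓝 t, x < lam - z := eventually_lt_nhds (by linarith)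
        have a2 : ∀ᶠ x in 𝓝 t, -lam - z < x := eventually_gt_nhds (by linarith)
        filter_upwards [a1, a2] with x hx hx2
        unfold xClamp
        rw [min_eq_right (by linarith), max_eq_right (by linarith)]; ring
      · rw [Set.indicator_of_notMem (by simp; intro h; linarith)]
        refine (hasDerivAt_const t ((z - lam) ^ 2)).congr_of_eventuallyEq ?_
        have : ∀ᶠ x in 𝓝 t, lam - z < x := eventually_gt_nhds (by linarith)
        filter_upwards [this] with x hx
        unfold xClamp
        rw [min_eq_left (by linarith), max_eq_right (by linarith)]

lemma xp_eq {lam : ℝ} (h : 0 ≤ lam) (t : ℝ) :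
    xp lam t = ∫ x in (-lam - t)..(lam - t), gaussianPDFReal 0 1 x := by
  unfold xp Measure.real
  rw [gaussianReal_apply_eq_integral 0 one_ne_zero, ENNReal.toReal_ofReal,
    intervalIntegral.integral_of_le (by linarith), integral_Ioc_eq_integral_Ioo]
  exact integral_nonneg fun x => gaussianPDFReal_nonneg 0 1 x

lemma xpdf (x : ℝ) : gaussianPDFReal 0 1 x = (√(2 * Real.pi))⁻¹ * Real.exp (-x ^ 2 / 2) := by
  rw [gaussianPDFReal_def]; simp

lemma xp_anti {lam : ℝ} (h : 0 ≤ lam) {s t : ℝ} (hs : 0 ≤ s) (hst : s ≤ t) :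
    xp lam t ≤ xp lam s := by
  have hi : ∀ a b, IntervalIntegrable (gaussianPDFReal 0 1) volume a b :=
    fun a b => (integrable_gaussianPDFReal 0 1).intervalIntegrable
  rw [xp_eq h, xp_eq h]
  have e1 := intervalIntegral.integral_add_adjacent_intervals (hi (-lam - t) (-lam - s))
    (hi (-lam - s) (lam - s))
  have e2 := intervalIntegral.integral_add_adjacent_intervals (hi (-lam - t) (lam - t))
    (hi (lam - t) (lam - s))
  have e3 : ∫ x in (-lam - t)..(-lam - s), gaussianPDFReal 0 1 x
      = ∫ x in (-t)..(-s), gaussianPDFReal 0 1 (x - lam) := by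
    rw [intervalIntegral.integral_comp_sub_right (gaussianPDFReal 0 1)]
    congr 1 <;> ring
  have e4 : ∫ x in (lam - t)..(lam - s), gaussianPDFReal 0 1 x
      = ∫ x in (-t)..(-s), gaussianPDFReal 0 1 (x + lam) := by
    rw [intervalIntegral.integral_comp_add_right (gaussianPDFReal 0 1)]
    congr 1 <;> ring
  have : ∫ x in (-t)..(-s), gaussianPDFReal 0 1 (x - lam)
      ≤ ∫ x in (-t)..(-s), gaussianPDFReal 0 1 (x + lam) := by
    refine intervalIntegral.integral_mono_on (by linarith) ?_ ?_ ?_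
    · exact ((integrable_gaussianPDFReal 0 1).comp_sub_right lam).intervalIntegrable
    · exact ((integrable_gaussianPDFReal 0 1).comp_add_right lam).intervalIntegrable
    · intro x hx
      rw [xpdf, xpdf]
      refine mul_le_mul_of_nonneg_left (Real.exp_le_exp.2 ?_) (by positivity)
      have := hx.2
      nlinarith
  linarith

lemma xr_tangent_nn {lam : ℝ} (h : 0 ≤ lam) {m t : ℝ} (hm : 0 ≤ m) (ht : 0 ≤ t) :
    xr lam t ≤ xr lam m + xp lam m * (t ^ 2 - m ^ 2) := by
  have hd : ∀ x, HasDerivAt (fun x => xr lam x - xp lam m * x ^ 2)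
      (xp lam x * (2 * x) - xp lam m * (2 * x)) x := by
    intro x
    have h2 : HasDerivAt (fun x : ℝ => x ^ 2) (2 * x) x := by
      simpa using hasDerivAt_pow 2 x
    exact (xr_deriv h x).sub (h2.const_mul _)
  have hcont : Continuous (fun x => xr lam x - xp lam m * x ^ 2) :=
    continuous_iff_continuousAt.2 fun x => (hd x).continuousAt
  rcases le_total t m with htm | htm
  · have : MonotoneOn (fun x => xr lam x - xp lam m * x ^ 2) (Set.Icc 0 m) := by
      refine monotoneOn_of_deriv_nonneg (convex_Icc _ _) hcont.continuousOn
        (fun x _ => (hd x).differentiableAt.differentiableWithinAt) ?_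
      intro x hx
      rw [interior_Icc] at hx
      rw [(hd x).deriv]
      have := xp_anti h hx.1.le hx.2.le
      nlinarith [hx.1]
    have := this ⟨ht, htm⟩ ⟨hm, le_rfl⟩ htm
    simp only at this
    linarith
  · have : AntitoneOn (fun x => xr lam x - xp lam m * x ^ 2) (Set.Ici m) := by
      refine antitoneOn_of_deriv_nonpos (convex_Ici _) hcont.continuousOn
        (fun x _ => (hd x).differentiableAt.differentiableWithinAt) ?_
      intro x hx
      rw [interior_Ici] at hx
      rw [(hd x).deriv]
      have hx' : m < x := hx
      have := xp_anti h hm hx'.le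
      nlinarith
    have := this (Set.mem_Ici.2 le_rfl) htm htm
    simp only at this
    linarith

lemma xr_tangent {lam : ℝ} (h : 0 ≤ lam) {m : ℝ} (hm : 0 ≤ m) (t : ℝ) :
    xr lam t ≤ xr lam m + xp lam m * (t ^ 2 - m ^ 2) := by
  rcases le_total 0 t with ht | ht
  · exact xr_tangent_nn h hm ht
  · have := xr_tangent_nn h hm (t := -t) (by linarith)
    rwa [xr_neg _ _ h, neg_sq] at this

lemma xsup_le {n k : ℕ} (hkn : k ≤ n) {lam s τ : ℝ} (hs : 0 < s) (hτ : 0 < τ) (hl : 0 ≤ lam)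
    {θ : Fin n → ℝ} (hθ : θ ∈ paramSet n k τ) :
    ∑ i, xr lam (θ i / s) ≤ ((n : ℝ) - k) * xr lam 0 + k * xr lam (τ / s) := by
  obtain ⟨h1, h2⟩ := hθ
  classical
  rw [Set.ncard_eq_toFinset_card'] at h1
  obtain ⟨S, hS, hSc⟩ := Finset.exists_superset_card_eq h1 (by simpa using hkn)
  have hz : ∀ i ∉ S, θ i = 0 := by
    intro i hi
    by_contra hne
    exact hi (hS (by simpa using hne))
  rw [← Finset.sum_add_sum_compl S]
  have a1 : ∑ i ∈ Sᶜ, xr lam (θ i / s) = ((n : ℝ) - k) * xr lam 0 := by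
    rw [Finset.sum_congr rfl (g := fun _ => xr lam 0)]
    · rw [Finset.sum_const, Finset.card_compl, hSc, Fintype.card_fin, nsmul_eq_mul,
        Nat.cast_sub hkn]
    · intro i hi
      rw [hz i (Finset.mem_compl.1 hi), zero_div]
  have a2 : ∑ i ∈ S, xr lam (θ i / s) ≤ k * xr lam (τ / s) := by
    calc _ ≤ ∑ i ∈ S, (xr lam (τ / s) + xp lam (τ / s) * ((θ i / s) ^ 2 - (τ / s) ^ 2)) :=
          Finset.sum_le_sum fun i _ => xr_tangent hl (by positivity) _
      _ = k * xr lam (τ / s) + xp lam (τ / s) * ((∑ i ∈ S, θ i ^ 2) - k * τ ^ 2) / s ^ 2 := by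
          rw [Finset.sum_add_distrib, ← Finset.mul_sum, Finset.sum_sub_distrib]
          simp only [Finset.sum_const, hSc, nsmul_eq_mul, div_pow]
          rw [← Finset.sum_div]
          field_simp
      _ ≤ _ := by
          have : ∑ i ∈ S, θ i ^ 2 ≤ ∑ i, θ i ^ 2 :=
            Finset.sum_le_sum_of_subset_of_nonneg (Finset.subset_univ _)
              fun _ _ _ => sq_nonneg _
          have hp : 0 ≤ xp lam (τ / s) := measureReal_nonneg
          have : xp lam (τ / s) * ((∑ i ∈ S, θ i ^ 2) - k * τ ^ 2) / s ^ 2 ≤ 0 := by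
            apply div_nonpos_of_nonpos_of_nonneg _ (by positivity)
            exact mul_nonpos_of_nonneg_of_nonpos hp (by linarith)
          linarith
  linarith

lemma xsup_ge {n k : ℕ} (hkn : k ≤ n) {s τ : ℝ} (lam : ℝ) :
    ∃ θ ∈ paramSet n k τ,
    ∑ i, xr lam (θ i / s) = ((n : ℝ) - k) * xr lam 0 + k * xr lam (τ / s) := by
  classical
  obtain ⟨S, hS, hSc⟩ := Finset.exists_superset_card_eq (s := (∅ : Finset (Fin n))) (n := k)
    (by simp) (by simpa using hkn)
  refine ⟨fun i => if i ∈ S then τ else 0, ⟨?_, ?_⟩, ?_⟩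
  · rw [← hSc, ← Set.ncard_coe_finset]
    refine Set.ncard_le_ncard ?_ (Finset.finite_toSet S)
    intro i hi
    by_contra hne
    simp at hi hne
    exact hne hi.1
  · simp [ite_pow, Finset.sum_ite_mem, hSc]
  · rw [← Finset.sum_add_sum_compl S, add_comm]
    congr 1
    · rw [Finset.sum_congr rfl (g := fun _ => xr lam 0)]
      · rw [Finset.sum_const, Finset.card_compl, hSc, Fintype.card_fin, nsmul_eq_mul,
          Nat.cast_sub hkn]
      · intro i hi
        simp [Finset.mem_compl.1 hi]
    · rw [Finset.sum_congr rfl (g := fun _ => xr lam (τ / s))]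
      · rw [Finset.sum_const, hSc, nsmul_eq_mul]
      · intro i hi
        simp [hi]

lemma xsup_eq {n k : ℕ} (hkn : k ≤ n) {lam s τ : ℝ} (hs : 0 < s) (hτ : 0 < τ) (hl : 0 ≤ lam) :
    ⨆ θ ∈ paramSet n k τ, risk n s (softEst n lam) θ = ENNReal.ofReal (s ^ 2 *
      (((n : ℝ) - k) * xr (lam / s) 0 + k * xr (lam / s) (τ / s))) := by
  apply le_antisymm
  · refine iSup₂_le fun θ hθ => ?_
    rw [xrisk n hs hl]
    apply ENNReal.ofReal_le_ofReal
    gcongr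
    exact xsup_le hkn hs hτ (by positivity) hθ
  · obtain ⟨θ, hθ, he⟩ := xsup_ge (s := s) (τ := τ) hkn (lam / s)
    rw [← he, ← xrisk n hs hl]
    exact le_iSup₂ (f := fun θ (_ : θ ∈ paramSet n k τ) => risk n s (softEst n lam) θ) θ hθ

def xG (j : ℕ) (a : ℝ) : ℝ := ∫ z, (max (z - a) 0) ^ j ∂(gaussianReal 0 1)

def xJ (j : ℕ) (a : ℝ) : ℝ := ∫ x in Set.Ioi (0 : ℝ), x ^ j * Real.exp (-a * x - x ^ 2 / 2)

lemma xG_int2 (a : ℝ) : Integrable (fun z => (max (z - a) 0) ^ 2) (gaussianReal 0 1) := by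
  refine Integrable.mono' ((xint_sq.const_mul 2).add (integrable_const (2 * a ^ 2))) ?_ ?_
  · exact (by fun_prop : Measurable _).aestronglyMeasurable
  · refine ae_of_all _ fun z => ?_
    rw [Real.norm_of_nonneg (sq_nonneg _)]
    simp only [Pi.add_apply]
    rcases le_total (z - a) 0 with h | h
    · rw [max_eq_right h]; nlinarith [sq_nonneg z, sq_nonneg a]
    · rw [max_eq_left h]; nlinarith [sq_nonneg (z + a)]

lemma xG_int1 (a : ℝ) : Integrable (fun z => (max (z - a) 0) ^ 1) (gaussianReal 0 1) := by
  refine Integrable.mono' ((xint_id.abs).add (integrable_const |a|)) ?_ ?_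
  · exact (by fun_prop : Measurable _).aestronglyMeasurable
  · refine ae_of_all _ fun z => ?_
    rw [pow_one, Real.norm_of_nonneg (le_max_right _ _)]
    simp only [Pi.add_apply]
    refine max_le ?_ (by positivity)
    have := le_abs_self z
    have := neg_abs_le a
    linarith

lemma xmp_neg : MeasurePreserving (fun z : ℝ => -z) (gaussianReal 0 1) (gaussianReal 0 1) := by
  refine ⟨measurable_neg, ?_⟩
  have h1 := gaussianReal_map_neg (μ := 0) (v := 1)
  rwa [neg_zero] at h1

lemma xmp_int (f : ℝ → ℝ) (hf : Integrable f (gaussianReal 0 1)) :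
    Integrable (fun z => f (-z)) (gaussianReal 0 1) ∧
    ∫ z, f (-z) ∂(gaussianReal 0 1) = ∫ z, f z ∂(gaussianReal 0 1) := by
  refine ⟨xmp_neg.integrable_comp_of_integrable hf, ?_⟩
  exact xmp_neg.integral_comp (MeasurableEquiv.neg ℝ).measurableEmbedding f

lemma xr_eq {lam : ℝ} (h : 0 ≤ lam) (m : ℝ) :
    xr lam m = m ^ 2 - 2 * m * (xG 1 (lam - m) - xG 1 (lam + m)) +
      xG 2 (lam - m) + xG 2 (lam + m) := by
  have hpt : ∀ z : ℝ, (z - xClamp lam (m + z)) ^ 2 =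
      m ^ 2 + (-(2 * m)) * (max (z - (lam - m)) 0) ^ 1 + (2 * m) * (max (-z - (lam + m)) 0) ^ 1
        + (max (z - (lam - m)) 0) ^ 2 + (max (-z - (lam + m)) 0) ^ 2 := by
    intro z
    unfold xClamp
    rcases le_total lam (m + z) with h1 | h1
    · rw [min_eq_left h1, max_eq_right (by linarith), max_eq_left (by linarith),
        max_eq_right (by linarith)]
      ring
    · rw [min_eq_right h1]
      rcases le_total (-lam) (m + z) with h2 | h2
      · rw [max_eq_right h2, max_eq_right (by linarith), max_eq_right (by linarith)]
        ring
      · rw [max_eq_left h2, max_eq_right (by linarith), max_eq_left (by linarith)]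
        ring
  unfold xr
  simp_rw [hpt]
  obtain ⟨i1, e1⟩ := xmp_int _ (xG_int1 (lam + m))
  obtain ⟨i2, e2⟩ := xmp_int _ (xG_int2 (lam + m))
  have j1 := xG_int1 (lam - m)
  have j2 := xG_int2 (lam - m)
  have c0 : Integrable (fun _ : ℝ => m ^ 2) (gaussianReal 0 1) := integrable_const _
  have k1 : Integrable (fun z => m ^ 2 + (-(2 * m)) * (max (z - (lam - m)) 0) ^ 1)
    (gaussianReal 0 1) := c0.add (j1.const_mul _)
  have k2 : Integrable (fun z => m ^ 2 + (-(2 * m)) * (max (z - (lam - m)) 0) ^ 1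
    + (2 * m) * (max (-z - (lam + m)) 0) ^ 1) (gaussianReal 0 1) := k1.add (i1.const_mul _)
  have k3 : Integrable (fun z => m ^ 2 + (-(2 * m)) * (max (z - (lam - m)) 0) ^ 1
    + (2 * m) * (max (-z - (lam + m)) 0) ^ 1 + (max (z - (lam - m)) 0) ^ 2)
    (gaussianReal 0 1) := k2.add j2
  rw [integral_add k3 i2, integral_add k2 j2, integral_add k1 (i1.const_mul _),
    integral_add c0 (j1.const_mul _), integral_const_mul, integral_const_mul, e1, e2]
  simp only [integral_const, probReal_univ, one_smul]
  unfold xG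
  ring

lemma xG_nonneg (j : ℕ) (a : ℝ) : 0 ≤ xG j a :=
  integral_nonneg fun _ => pow_nonneg (le_max_right _ _) _

lemma xG_eq {j : ℕ} (hj : j ≠ 0) (a : ℝ) :
    xG j a = (√(2 * Real.pi))⁻¹ * Real.exp (-a ^ 2 / 2) * xJ j a := by
  unfold xG xJ
  rw [integral_gaussianReal_eq_integral_smul one_ne_zero, ← integral_add_right_eq_self _ a,
    ← integral_indicator measurableSet_Ioi, ← integral_const_mul]
  refine integral_congr_ae (ae_of_all _ fun x => ?_)
  simp only [smul_eq_mul, add_sub_cancel_right, xpdf]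
  by_cases hx : 0 < x
  · rw [Set.indicator_of_mem (Set.mem_Ioi.2 hx), max_eq_left hx.le]
    have : Real.exp (-(x + a) ^ 2 / 2) = Real.exp (-a ^ 2 / 2) * Real.exp (-a * x - x ^ 2 / 2) := by
      rw [← Real.exp_add]; congr 1; ring
    rw [this]; ring
  · rw [Set.indicator_of_notMem (by simpa using hx), max_eq_right (not_lt.1 hx), zero_pow hj]
    simp

lemma xJ_int (j : ℕ) (a : ℝ) :
    IntegrableOn (fun x : ℝ => x ^ j * Real.exp (-a * x - x ^ 2 / 2)) (Set.Ioi 0) := by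
  have h := (integrable_rpow_mul_exp_neg_mul_sq (b := 1 / 4) (by norm_num) (s := j)
    (by have : (0 : ℝ) ≤ j := Nat.cast_nonneg j
        linarith)).integrableOn (s := Set.Ioi 0)
  refine Integrable.mono' (h.const_mul (Real.exp (a ^ 2))) ?_ ?_
  · exact (by fun_prop : Measurable _).aestronglyMeasurable
  · refine (ae_restrict_iff' measurableSet_Ioi).2 (ae_of_all _ fun x hx => ?_)
    have hx : 0 < x := hx
    rw [Real.norm_of_nonneg (by positivity), Real.rpow_natCast, mul_left_comm, ← Real.exp_add]
    gcongr
    nlinarith [sq_nonneg (a + x / 2)]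

lemma xJ_anti (j : ℕ) {a b : ℝ} (h : a ≤ b) : xJ j b ≤ xJ j a := by
  refine setIntegral_mono_on (xJ_int j b) (xJ_int j a) measurableSet_Ioi fun x hx => ?_
  have hx : 0 < x := hx
  gcongr

lemma xJ_nonneg (j : ℕ) (a : ℝ) : 0 ≤ xJ j a := by
  refine setIntegral_nonneg measurableSet_Ioi fun x hx => ?_
  have hx : 0 < x := hx
  positivity

lemma xJ_le (j : ℕ) {a : ℝ} (ha : 0 < a) : xJ j a ≤ j.factorial / a ^ (j + 1) := by
  have h := Real.integral_rpow_mul_exp_neg_mul_Ioi (a := j + 1) (r := a) (by positivity) ha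
  rw [Real.Gamma_nat_eq_factorial] at h
  have e : (1 / a) ^ ((j : ℝ) + 1) = 1 / a ^ (j + 1) := by
    rw [← Nat.cast_add_one, Real.rpow_natCast, one_div_pow]
  rw [e] at h
  have hi : IntegrableOn (fun t : ℝ => t ^ ((j : ℝ) + 1 - 1) * Real.exp (-(a * t))) (Set.Ioi 0) := by
    apply MeasureTheory.Integrable.of_integral_ne_zero
    rw [h]; positivity
  calc xJ j a ≤ ∫ t in Set.Ioi (0 : ℝ), t ^ ((j : ℝ) + 1 - 1) * Real.exp (-(a * t)) := by
        refine setIntegral_mono_on (xJ_int j a) hi measurableSet_Ioi fun x hx => ?_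
        have hx : 0 < x := hx
        rw [add_sub_cancel_right, Real.rpow_natCast]
        gcongr
        nlinarith [sq_nonneg x]
    _ = _ := by rw [h]; ring

lemma xexp15 : (1 / 5 : ℝ) ≤ Real.exp (-(3 / 2)) := by
  rw [Real.exp_neg, one_div]
  apply inv_anti₀ (Real.exp_pos _)
  have h1 := Real.exp_one_lt_d9
  have h2 : Real.exp (3 / 2) * Real.exp (3 / 2) = Real.exp 1 * Real.exp 1 * Real.exp 1 := by
    rw [← Real.exp_add, ← Real.exp_add, ← Real.exp_add]; norm_num
  have h0 := Real.exp_pos 1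
  by_contra hc
  push Not at hc
  have h3 : Real.exp 1 * Real.exp 1 ≤ 2.7182818286 * 2.7182818286 :=
    mul_le_mul h1.le h1.le h0.le (by norm_num)
  have h4 : Real.exp 1 * Real.exp 1 * Real.exp 1 ≤ 2.7182818286 * 2.7182818286 * 2.7182818286 :=
    mul_le_mul h3 h1.le h0.le (by norm_num)
  nlinarith

lemma xJ_ge (j : ℕ) {a : ℝ} (ha : 0 ≤ a) : 1 / (5 * (j + 1) * (a + 1) ^ (j + 1)) ≤ xJ j a := by
  set d : ℝ := 1 / (a + 1) with hd
  have hd0 : 0 < d := by positivity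
  have hd1 : d ≤ 1 := by rw [hd, div_le_one (by positivity)]; linarith
  have had : a * d ≤ 1 := by
    rw [hd, mul_one_div, div_le_one (by positivity)]; linarith
  have h1 : ∫ x in (0 : ℝ)..d, x ^ j * (1 / 5) = 1 / (5 * (j + 1) * (a + 1) ^ (j + 1)) := by
    rw [intervalIntegral.integral_mul_const, integral_pow, hd]
    simp only [one_div_pow, zero_pow (Nat.succ_ne_zero j), sub_zero]
    field_simp
  rw [← h1, intervalIntegral.integral_of_le hd0.le]
  calc _ ≤ ∫ x in Set.Ioc 0 d, x ^ j * Real.exp (-a * x - x ^ 2 / 2) := by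
        refine setIntegral_mono_on ?_ ((xJ_int j a).mono_set Set.Ioc_subset_Ioi_self)
          measurableSet_Ioc fun x hx => ?_
        · exact ((by fun_prop : Continuous fun x : ℝ => x ^ j * (1 / 5)).integrableOn_Icc).mono_set
            Set.Ioc_subset_Icc_self
        · have h0 := hx.1
          have h2 := hx.2
          refine mul_le_mul_of_nonneg_left (xexp15.trans (Real.exp_le_exp.2 ?_)) (by positivity)
          have : a * x ≤ 1 := (mul_le_mul_of_nonneg_left h2 ha).trans had
          nlinarith
    _ ≤ _ := by
        refine setIntegral_mono_set (xJ_int j a) ?_ (Set.Ioc_subset_Ioi_self.eventuallyLE)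
        refine (ae_restrict_iff' measurableSet_Ioi).2 (ae_of_all _ fun x hx => ?_)
        have hx : 0 < x := hx
        simp only [Pi.zero_apply]
        positivity

lemma xJ_ratio {a : ℝ} (ha : 400 ≤ a) : xJ 2 a ≤ xJ 1 a / 2 := by
  have h1 := xJ_le 2 (a := a) (by linarith)
  have h2 := xJ_ge 1 (a := a) (by linarith)
  norm_num at h1 h2
  refine h1.trans ((?_ : _ ≤ _).trans (div_le_div_of_nonneg_right h2 (by norm_num)))
  have he : ((a + 1) ^ 2)⁻¹ * (1 / 10) / 2 = 1 / (20 * (a + 1) ^ 2) := by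
    field_simp; norm_num
  rw [he, div_le_div_iff₀ (by positivity) (by positivity)]
  have : (a + 1) ^ 2 ≤ 4 * a ^ 2 := by nlinarith
  have : a ^ 3 ≥ 400 * a ^ 2 := by nlinarith [sq_nonneg a]
  nlinarith

lemma xG1_neg {m : ℝ} (hm : 0 ≤ m) : xG 1 (-m) ≤ 2 + m := by
  have h2 : ∫ z, z ^ 2 ∂(gaussianReal 0 1) = 1 := by
    have := variance_fun_id_gaussianReal (μ := 0) (v := 1)
    rw [variance_eq_integral (by fun_prop)] at this
    simpa using this
  calc xG 1 (-m) ≤ ∫ z, (z ^ 2 + (1 + m)) ∂(gaussianReal 0 1) := by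
        refine integral_mono (xG_int1 _) (xint_sq.add (integrable_const _)) fun z => ?_
        simp only [pow_one]
        refine max_le ?_ (by positivity)
        nlinarith [sq_nonneg (z - 1 / 2)]
    _ = 2 + m := by
        rw [integral_add xint_sq (integrable_const _), h2]
        simp; ring

def xA (e m lam : ℝ) : ℝ := e * (m ^ 2 - xr lam m) - (1 - e) * xr lam 0

lemma xA_eq {lam : ℝ} (h : 0 ≤ lam) (e m : ℝ) :
    xA e m lam = e * (2 * m * (xG 1 (lam - m) - xG 1 (lam + m)) - xG 2 (lam - m) - xG 2 (lam + m))
      - (1 - e) * (2 * xG 2 lam) := by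
  unfold xA
  rw [xr_eq h m, xr_eq h 0, sub_zero, add_zero]
  ring

lemma xs_pos : 0 < √(2 * Real.pi) := by
  have := Real.pi_pos
  positivity

lemma xs_le : √(2 * Real.pi) ≤ 3 := by
  rw [Real.sqrt_le_left (by norm_num)]
  have := Real.pi_lt_d2
  linarith

lemma xs_ge : 1 ≤ √(2 * Real.pi) := by
  rw [Real.one_le_sqrt]
  have := Real.pi_gt_three
  linarith

set_option maxHeartbeats 1600000 in
lemma xA_upper {d m l e : ℝ} (hd : 0 < d) (hd1 : d ≤ 1 / 10) (hm : 1 ≤ m) (hml : m ≤ d * l)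
    (hl : 400 / d ≤ l) (he : e = Real.exp (-(l * m))) (he2 : e ≤ 1 / 2)
    (h5 : 2160 * (l * m) ^ 5 ≤ Real.exp (d * (l * m)))
    {lam : ℝ} (hlam : 0 ≤ lam) : xA e m lam ≤ Real.exp (-((1 - 5 * d) * (l ^ 2 / 2))) := by
  have hl400 : 4000 ≤ l := by
    refine le_trans ?_ hl
    rw [le_div_iff₀ hd]; linarith
  have he0 : 0 < e := he ▸ Real.exp_pos _
  rw [xA_eq hlam]
  have p1 := xG_nonneg 1 (lam - m)
  have p2 := xG_nonneg 1 (lam + m)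
  have p3 := xG_nonneg 2 (lam - m)
  have p4 := xG_nonneg 2 (lam + m)
  have p5 := xG_nonneg 2 lam
  have hs := xs_pos
  have hs3 := xs_le
  rcases le_total lam ((1 - d) * l) with hc | hc
  · refine le_trans ?_ (Real.exp_pos _).le
    have q1 : e * (2 * m * (xG 1 (lam - m) - xG 1 (lam + m)) - xG 2 (lam - m) - xG 2 (lam + m))
        ≤ e * (2 * m * xG 1 (lam - m)) := by
      gcongr
      nlinarith [mul_nonneg (by linarith : 0 ≤ m) p2]
    have q2 : (1 - e) * (2 * xG 2 lam) ≥ xG 2 lam := by nlinarith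
    suffices h : e * (2 * m * xG 1 (lam - m)) ≤ xG 2 lam by linarith
    have r1 : Real.exp (-m ^ 2 / 2) * xJ 1 (-m) ≤ 3 * (2 + m) := by
      have := xG1_neg (by linarith : 0 ≤ m)
      rw [xG_eq one_ne_zero, neg_sq, mul_assoc, inv_mul_le_iff₀ hs] at this
      refine this.trans ?_
      gcongr
    rw [xG_eq one_ne_zero, xG_eq two_ne_zero]
    have r2 : Real.exp (-(lam - m) ^ 2 / 2)
        = Real.exp (-lam ^ 2 / 2) * Real.exp (lam * m) * Real.exp (-m ^ 2 / 2) := by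
      rw [← Real.exp_add, ← Real.exp_add]; congr 1; ring
    have r3 : xJ 1 (lam - m) ≤ xJ 1 (-m) := xJ_anti 1 (by linarith)
    have r4 := xJ_ge 2 hlam
    norm_num at r4
    have r5 : e * Real.exp (lam * m) ≤ Real.exp (-(d * (l * m))) := by
      rw [he, ← Real.exp_add]
      apply Real.exp_le_exp.2
      nlinarith
    have hlm : m ≤ l * m := by nlinarith
    have hlm2 : l ≤ l * m := by nlinarith
    have r6 : 6 * (m * (2 + m)) * (15 * (lam + 1) ^ 3) ≤ Real.exp (d * (l * m)) := by
      refine le_trans ?_ h5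
      have b1 : m * (2 + m) ≤ 3 * (l * m) ^ 2 := by nlinarith
      have b2 : (lam + 1) ^ 3 ≤ (2 * (l * m)) ^ 3 := by
        gcongr
        nlinarith
      calc 6 * (m * (2 + m)) * (15 * (lam + 1) ^ 3)
          ≤ 6 * (3 * (l * m) ^ 2) * (15 * (2 * (l * m)) ^ 3) := by gcongr
        _ = _ := by ring
    have r7 : 6 * (m * (2 + m)) * Real.exp (-(d * (l * m))) ≤ 1 / (15 * (lam + 1) ^ 3) := by
      rw [Real.exp_neg, ← div_eq_mul_inv, div_le_div_iff₀ (Real.exp_pos _) (by positivity)]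
      linarith
    have r8 : 1 / (15 * (lam + 1) ^ 3) ≤ xJ 2 lam := by
      refine le_trans (le_of_eq ?_) r4
      field_simp
      try norm_num
    rw [r2]
    calc e * (2 * m * ((√(2 * Real.pi))⁻¹ * (Real.exp (-lam ^ 2 / 2) * Real.exp (lam * m)
            * Real.exp (-m ^ 2 / 2)) * xJ 1 (lam - m)))
        = (√(2 * Real.pi))⁻¹ * Real.exp (-lam ^ 2 / 2) * ((e * Real.exp (lam * m)) * (2 * m)
          * (Real.exp (-m ^ 2 / 2) * xJ 1 (lam - m))) := by ring
      _ ≤ (√(2 * Real.pi))⁻¹ * Real.exp (-lam ^ 2 / 2) * (Real.exp (-(d * (l * m))) * (2 * m)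
          * (3 * (2 + m))) := by
          have : Real.exp (-m ^ 2 / 2) * xJ 1 (lam - m) ≤ 3 * (2 + m) :=
            le_trans (by gcongr) r1
          have := xJ_nonneg 1 (lam - m)
          gcongr
      _ ≤ _ := by
          gcongr
          linarith
  · have hb : (1 - 2 * d) * l ≤ lam - m := by nlinarith
    have hb1 : 1 ≤ lam - m := by nlinarith
    have q1 : e * (2 * m * (xG 1 (lam - m) - xG 1 (lam + m)) - xG 2 (lam - m) - xG 2 (lam + m))
        ≤ 1 * (2 * m * xG 1 (lam - m)) := by
      refine le_trans (b := e * (2 * m * xG 1 (lam - m))) ?_ ?_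
      · gcongr
        nlinarith [mul_nonneg (by linarith : 0 ≤ m) p2]
      · gcongr
        linarith
    have q2 : 0 ≤ (1 - e) * (2 * xG 2 lam) := by
      have : 0 ≤ 1 - e := by linarith
      positivity
    have q3 : xG 1 (lam - m) ≤ Real.exp (-(lam - m) ^ 2 / 2) := by
      rw [xG_eq one_ne_zero]
      have j := xJ_le 1 (a := lam - m) (by linarith)
      have j2 : xJ 1 (lam - m) ≤ 1 := by
        refine j.trans ?_
        rw [div_le_one (by positivity)]
        rw [Nat.factorial_one, Nat.cast_one]
        exact one_le_pow₀ hb1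
      have := inv_le_one_of_one_le₀ xs_ge
      have := xJ_nonneg 1 (lam - m)
      calc _ ≤ 1 * Real.exp (-(lam - m) ^ 2 / 2) * 1 := by gcongr
        _ = _ := by ring
    have q4 : 2 * m ≤ Real.exp (d * l ^ 2 / 2) := by
      have := Real.add_one_le_exp (d * l ^ 2 / 2)
      nlinarith
    calc _ ≤ 2 * m * xG 1 (lam - m) := by linarith
      _ ≤ Real.exp (d * l ^ 2 / 2) * Real.exp (-(lam - m) ^ 2 / 2) := by gcongr
      _ ≤ _ := by
        rw [← Real.exp_add]
        apply Real.exp_le_exp.2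
        have : ((1 - 2 * d) * l) ^ 2 ≤ (lam - m) ^ 2 := by
          gcongr
          have : 0 ≤ 1 - 2 * d := by linarith
          positivity
        nlinarith [sq_nonneg (d * l)]

set_option maxHeartbeats 1600000 in
lemma xA_lower {d m l e : ℝ} (hd : 0 < d) (hd1 : d ≤ 1 / 10) (hm : 1 ≤ m) (hml : m ≤ d * l)
    (hl : 400 / d ≤ l) (he : e = Real.exp (-(l * m)))
    (h2 : 270 * l ^ 2 ≤ Real.exp (d * l ^ 2)) :
    Real.exp (-((1 + 5 * d) * (l ^ 2 / 2))) ≤ xA e m ((1 + d) * l) := by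
  have hdl : 400 ≤ d * l := by rw [div_le_iff₀ hd] at hl; linarith
  have hl400 : 4000 ≤ l := by nlinarith
  have he0 : 0 < e := he ▸ Real.exp_pos _
  set lam := (1 + d) * l with hlamd
  have hlam : 400 ≤ lam := by nlinarith
  have hlam0 : 0 ≤ lam := by linarith
  rw [xA_eq hlam0]
  have hb : 400 ≤ lam - m := by nlinarith
  have hs := xs_pos
  have hs3 := xs_le
  have p1 := xG_nonneg 1 (lam - m)
  have p5 := xG_nonneg 2 lam
  have g : ∀ a : ℝ, 400 ≤ a → xG 2 a ≤ xG 1 a / 2 := by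
    intro a ha
    rw [xG_eq one_ne_zero, xG_eq two_ne_zero, mul_div_assoc]
    gcongr
    exact xJ_ratio ha
  have g1 := g _ hb
  have g2 := g (lam + m) (by linarith)
  have g3 : xG 1 (lam + m) ≤ xG 1 (lam - m) / 8 := by
    rw [xG_eq one_ne_zero, xG_eq one_ne_zero]
    have e1 : Real.exp (-(lam + m) ^ 2 / 2)
        = Real.exp (-(2 * lam * m)) * Real.exp (-(lam - m) ^ 2 / 2) := by
      rw [← Real.exp_add]; congr 1; ring
    have e2 : Real.exp (-(2 * lam * m)) ≤ 1 / 8 := by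
      rw [Real.exp_neg, ← one_div]
      apply one_div_le_one_div_of_le (by norm_num)
      have := Real.add_one_le_exp (2 * lam * m)
      nlinarith
    have e3 : xJ 1 (lam + m) ≤ xJ 1 (lam - m) := xJ_anti 1 (by linarith)
    have := xJ_nonneg 1 (lam + m)
    rw [e1]
    calc _ ≤ (√(2 * Real.pi))⁻¹ * (1 / 8 * Real.exp (-(lam - m) ^ 2 / 2)) * xJ 1 (lam - m) := by
          gcongr
      _ = _ := by ring
  have s1 : m * xG 1 (lam - m) ≤
      2 * m * (xG 1 (lam - m) - xG 1 (lam + m)) - xG 2 (lam - m) - xG 2 (lam + m) := by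
    have a1 : xG 1 (lam - m) ≤ m * xG 1 (lam - m) := by nlinarith
    have a2 : m * xG 1 (lam + m) ≤ m * (xG 1 (lam - m) / 8) := by gcongr
    linarith
  have s2 : (1 - e) * (2 * xG 2 lam) ≤ xG 1 lam := by
    have := g lam hlam
    nlinarith
  have s3 : 2 * xG 1 lam ≤ e * (m * xG 1 (lam - m)) := by
    rw [xG_eq one_ne_zero, xG_eq one_ne_zero]
    have r2 : Real.exp (-(lam - m) ^ 2 / 2)
        = Real.exp (-lam ^ 2 / 2) * Real.exp (lam * m - m ^ 2 / 2) := by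
      rw [← Real.exp_add]; congr 1; ring
    have r3 : xJ 1 lam ≤ xJ 1 (lam - m) := xJ_anti 1 (by linarith)
    have r5 : 2 ≤ e * Real.exp (lam * m - m ^ 2 / 2) := by
      rw [he, ← Real.exp_add]
      have := Real.add_one_le_exp (-(l * m) + (lam * m - m ^ 2 / 2))
      refine le_trans ?_ this
      rw [hlamd]
      nlinarith
    have := xJ_nonneg 1 lam
    rw [r2]
    calc 2 * ((√(2 * Real.pi))⁻¹ * Real.exp (-lam ^ 2 / 2) * xJ 1 lam)
        ≤ (e * Real.exp (lam * m - m ^ 2 / 2)) *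
          ((√(2 * Real.pi))⁻¹ * Real.exp (-lam ^ 2 / 2) * xJ 1 (lam - m)) := by gcongr
      _ ≤ m * ((e * Real.exp (lam * m - m ^ 2 / 2)) *
          ((√(2 * Real.pi))⁻¹ * Real.exp (-lam ^ 2 / 2) * xJ 1 (lam - m))) := by
          refine le_mul_of_one_le_left ?_ hm
          have := xJ_nonneg 1 (lam - m)
          positivity
      _ = _ := by ring
  have s4 : xG 1 lam ≤ e * (2 * m * (xG 1 (lam - m) - xG 1 (lam + m)) - xG 2 (lam - m)
      - xG 2 (lam + m)) - (1 - e) * (2 * xG 2 lam) := by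
    have := mul_le_mul_of_nonneg_left s1 he0.le
    linarith
  refine le_trans ?_ s4
  rw [xG_eq one_ne_zero]
  have j := xJ_ge 1 hlam0
  have j' : 1 / (10 * (lam + 1) ^ 2) ≤ xJ 1 lam := by
    refine le_trans (le_of_eq ?_) j
    norm_num
    try ring
  have hi : (1 / 3 : ℝ) ≤ (√(2 * Real.pi))⁻¹ := by
    rw [one_div]
    exact inv_anti₀ hs hs3
  have k : Real.exp (-(d * l ^ 2)) ≤ 1 / 3 * (1 / (10 * (lam + 1) ^ 2)) := by
    have : 1 / 3 * (1 / (10 * (lam + 1) ^ 2)) = 1 / (30 * (lam + 1) ^ 2) := by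
      field_simp; try norm_num
    rw [this, Real.exp_neg, ← one_div]
    apply one_div_le_one_div_of_le (by positivity)
    refine le_trans ?_ h2
    have : (lam + 1) ^ 2 ≤ (2 * l) ^ 2 := by
      gcongr
      rw [hlamd]; nlinarith
    nlinarith
  calc _ ≤ Real.exp (-lam ^ 2 / 2) * Real.exp (-(d * l ^ 2)) := by
        rw [← Real.exp_add]
        apply Real.exp_le_exp.2
        rw [hlamd]
        have : d ^ 2 * l ^ 2 ≤ d * l ^ 2 := by
          gcongr
          nlinarith
        nlinarith
    _ ≤ Real.exp (-lam ^ 2 / 2) * (1 / 3 * (1 / (10 * (lam + 1) ^ 2))) := by gcongr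
    _ ≤ Real.exp (-lam ^ 2 / 2) * ((√(2 * Real.pi))⁻¹ * xJ 1 lam) := by gcongr
    _ = _ := by ring

def xV (n k : ℕ) (τ s : ℝ) : ℝ≥0∞ :=
  ⨅ (lam : ℝ) (_ : 0 ≤ lam), ⨆ θ ∈ paramSet n k τ, risk n s (softEst n lam) θ

lemma xsup_eq' {n k : ℕ} (hn : 1 ≤ n) (hkn : k ≤ n) {lam s τ : ℝ} (hs : 0 < s) (hτ : 0 < τ)
    (hl : 0 ≤ lam) :
    ⨆ θ ∈ paramSet n k τ, risk n s (softEst n lam) θ = ENNReal.ofReal (n * s ^ 2 *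
      ((k / n : ℝ) * (τ / s) ^ 2 - xA (k / n) (τ / s) (lam / s))) := by
  rw [xsup_eq hkn hs hτ hl]
  congr 1
  have : (0 : ℝ) < n := by exact_mod_cast hn
  unfold xA
  field_simp
  ring

lemma xV_bounds {n k : ℕ} (hn : 1 ≤ n) (hkn : k ≤ n) {s τ : ℝ} (hs : 0 < s) (hτ : 0 < τ)
    {a b lam0 : ℝ} (h0 : 0 ≤ lam0) (ha : a ≤ xA (k / n) (τ / s) lam0)
    (hb : ∀ lam, 0 ≤ lam → xA (k / n) (τ / s) lam ≤ b) :
    xV n k τ s ≠ ⊤ ∧ a ≤ (k / n : ℝ) * (τ / s) ^ 2 - (xV n k τ s).toReal / (n * s ^ 2) ∧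
      (k / n : ℝ) * (τ / s) ^ 2 - (xV n k τ s).toReal / (n * s ^ 2) ≤ b := by
  have hn' : (0 : ℝ) < n := by exact_mod_cast hn
  have hp : 0 < (n : ℝ) * s ^ 2 := by positivity
  have h1 : xV n k τ s ≤ ENNReal.ofReal (n * s ^ 2 *
      ((k / n : ℝ) * (τ / s) ^ 2 - xA (k / n) (τ / s) lam0)) := by
    have e : lam0 = lam0 * s / s := by field_simp
    rw [e, ← xsup_eq' hn hkn hs hτ (by positivity)]
    exact iInf₂_le (lam0 * s) (by positivity)
  have hnt : xV n k τ s ≠ ⊤ := ne_top_of_le_ne_top ENNReal.ofReal_ne_top h1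
  refine ⟨hnt, ?_, ?_⟩
  · have hnn : 0 ≤ (k / n : ℝ) * (τ / s) ^ 2 - xA (k / n) (τ / s) lam0 := by
      have e : (k / n : ℝ) * (τ / s) ^ 2 - xA (k / n) (τ / s) lam0
        = (k / n : ℝ) * xr lam0 (τ / s) + (1 - k / n) * xr lam0 0 := by
        unfold xA; ring
      rw [e]
      have := xr_nonneg lam0 (τ / s)
      have := xr_nonneg lam0 0
      have : 0 ≤ 1 - (k : ℝ) / n := by
        rw [sub_nonneg, div_le_one hn']; exact_mod_cast hkn
      positivity
    have h2 := ENNReal.toReal_le_of_le_ofReal (by positivity) h1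
    rw [mul_comm, ← div_le_iff₀ hp] at h2
    linarith
  · have h3 : ENNReal.ofReal (n * s ^ 2 * ((k / n : ℝ) * (τ / s) ^ 2 - b)) ≤ xV n k τ s := by
      refine le_iInf₂ fun lam hl => ?_
      rw [xsup_eq' hn hkn hs hτ hl]
      apply ENNReal.ofReal_le_ofReal
      gcongr
      exact hb _ (by positivity)
    rw [ENNReal.ofReal_le_iff_le_toReal hnt, mul_comm, ← le_div_iff₀ hp] at h3
    linarith

lemma xevent (ε μ : ℕ → ℝ) (hpos : ∀ᶠ n in atTop, 0 < ε n)
    (hε0 : Tendsto ε atTop (𝓝 0)) (hμtop : Tendsto μ atTop atTop)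
    (hμo : Tendsto (fun n => μ n / Real.sqrt (Real.log (ε n)⁻¹)) atTop (𝓝 0))
    {d : ℝ} (hd : 0 < d) (hd1 : d ≤ 1 / 10) :
    ∀ᶠ n in atTop, 0 < Real.log (1 / ε n) / μ n ∧ 0 < μ n ∧
      (∀ lam, 0 ≤ lam → xA (ε n) (μ n) lam ≤
        Real.exp (-((1 - 5 * d) * ((Real.log (1 / ε n) / μ n) ^ 2 / 2)))) ∧
      Real.exp (-((1 + 5 * d) * ((Real.log (1 / ε n) / μ n) ^ 2 / 2))) ≤
        xA (ε n) (μ n) ((1 + d) * (Real.log (1 / ε n) / μ n)) := by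
  have hL : Tendsto (fun n => Real.log (1 / ε n)) atTop atTop := by
    refine Real.tendsto_log_atTop.comp ?_
    have : Tendsto ε atTop (𝓝[>] 0) := tendsto_nhdsWithin_iff.2 ⟨hε0, hpos⟩
    simpa [Function.comp_def] using tendsto_inv_nhdsGT_zero.comp this
  have hsq := hμo.pow 2
  rw [zero_pow two_ne_zero] at hsq
  have c1 := hsq.eventually_lt_const hd
  have hpoly : ∀ j : ℕ, ∀ C : ℝ, 0 < C → ∀ᶠ x : ℝ in atTop, C * x ^ j ≤ Real.exp (d * x) := by
    intro j C hC
    have h := (isLittleO_pow_exp_pos_mul_atTop j hd).bound (c := 1 / C) (by positivity)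
    filter_upwards [h, eventually_ge_atTop 0] with x hx hx0
    rw [Real.norm_of_nonneg (by positivity), Real.norm_of_nonneg (Real.exp_pos _).le] at hx
    rw [one_div, ← div_eq_inv_mul, le_div_iff₀ hC] at hx
    linarith
  have key : ∀ᶠ n in atTop, 0 < ε n ∧ 0 < Real.log (1 / ε n) ∧ 400 ≤ μ n ∧
      μ n ^ 2 ≤ d * Real.log (1 / ε n) := by
    filter_upwards [hpos, hL.eventually_gt_atTop 0, hμtop.eventually_ge_atTop 400, c1]
      with n h1 h2 h3 h4
    refine ⟨h1, h2, h3, ?_⟩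
    rw [← one_div, div_pow, Real.sq_sqrt h2.le, div_lt_iff₀ h2] at h4
    exact h4.le
  have key2 : ∀ᶠ n in atTop, μ n ≤ d * (Real.log (1 / ε n) / μ n) := by
    filter_upwards [key] with n ⟨h1, h2, h3, h4⟩
    rw [← mul_div_assoc, le_div_iff₀ (by linarith)]
    linarith
  have hl2 : Tendsto (fun n => (Real.log (1 / ε n) / μ n) ^ 2) atTop atTop := by
    refine (tendsto_pow_atTop two_ne_zero).comp (tendsto_atTop_mono' _ ?_ hμtop)
    filter_upwards [key, key2] with n ⟨h1, h2, h3, h4⟩ h5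
    have : 0 < Real.log (1 / ε n) / μ n := div_pos h2 (by linarith)
    nlinarith
  filter_upwards [key, key2, hL.eventually (hpoly 5 2160 (by norm_num)),
    hl2.eventually (hpoly 1 270 (by norm_num)), hε0.eventually_le_const (by norm_num : (0 : ℝ) < 1 / 2)]
    with n ⟨h1, h2, h3, h4⟩ h5 h6 h7 h8
  have hm : 0 < μ n := by linarith
  have hlm : Real.log (1 / ε n) / μ n * μ n = Real.log (1 / ε n) := by field_simp
  have hl : 400 / d ≤ Real.log (1 / ε n) / μ n := by
    rw [div_le_iff₀ hd]; linarith
  have he : ε n = Real.exp (-(Real.log (1 / ε n) / μ n * μ n)) := by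
    rw [hlm, one_div, Real.log_inv, neg_neg, Real.exp_log h1]
  rw [pow_one] at h7
  refine ⟨div_pos h2 hm, hm, fun lam h0 => ?_, ?_⟩
  · exact xA_upper hd hd1 (by linarith) h5 hl he h8 (by rw [hlm]; exact h6) h0
  · exact xA_lower hd hd1 (by linarith) h5 hl he h7

/-- Proposition `lem::lasso-risk-regime-2`. -/
theorem statement5
    (k : ℕ → ℕ) (τ σ ε μ : ℕ → ℝ)
    (hk : ∀ n, 1 ≤ n → 1 ≤ k n ∧ k n ≤ n)
    (hτ : ∀ n, 0 < τ n) (hσ : ∀ n, 0 < σ n)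
    (hε : ∀ n, ε n = (k n : ℝ) / n) (hμ : ∀ n, μ n = τ n / σ n)
    (hε0 : Tendsto ε atTop (𝓝 0)) (hμtop : Tendsto μ atTop atTop)
    (hμo : Tendsto (fun n => μ n / Real.sqrt (Real.log (ε n)⁻¹)) atTop (𝓝 0)) :
    ∃ c : ℕ → ℝ, Tendsto c atTop (𝓝 1) ∧
      ∀ᶠ n : ℕ in atTop,
        (⨅ (lam : ℝ) (_ : 0 ≤ lam),
            ⨆ θ ∈ paramSet n (k n) (τ n), risk n (σ n) (softEst n lam) θ) =
          ENNReal.ofReal ((n : ℝ) * σ n ^ 2 *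
            (ε n * μ n ^ 2 -
              Real.exp (-(1 / 2) * (1 / μ n ^ 2) * Real.log (1 / ε n) ^ 2 * c n))) := by
  have hpos : ∀ᶠ n in atTop, 0 < ε n := by
    filter_upwards [eventually_ge_atTop 1] with n hn
    rw [hε]
    have h1 : (0 : ℝ) < n := by exact_mod_cast hn
    have h2 : (0 : ℝ) < k n := by exact_mod_cast (hk n hn).1
    positivity
  set A : ℕ → ℝ := fun n =>
    ε n * μ n ^ 2 - (xV n (k n) (τ n) (σ n)).toReal / (n * σ n ^ 2) with hA
  set q : ℕ → ℝ := fun n => (Real.log (1 / ε n) / μ n) ^ 2 / 2 with hq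
  have main : ∀ d : ℝ, 0 < d → d ≤ 1 / 10 → ∀ᶠ n in atTop, 1 ≤ n ∧ 0 < q n ∧ 0 < μ n ∧
      xV n (k n) (τ n) (σ n) ≠ ⊤ ∧ Real.exp (-((1 + 5 * d) * q n)) ≤ A n ∧
      A n ≤ Real.exp (-((1 - 5 * d) * q n)) := by
    intro d hd hd1
    filter_upwards [xevent ε μ hpos hε0 hμtop hμo hd hd1, eventually_ge_atTop 1]
      with n ⟨h1, h2, h3, h4⟩ hn
    have h0 : 0 ≤ (1 + d) * (Real.log (1 / ε n) / μ n) := by positivity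
    rw [hε, hμ] at h3 h4
    rw [hε, hμ] at h0
    obtain ⟨b1, b2, b3⟩ := xV_bounds hn (hk n hn).2 (hσ n) (hτ n) h0 h4 h3
    rw [← hε, ← hμ] at b2 b3
    exact ⟨hn, by simp only [hq]; positivity, h2, b1, b2, b3⟩
  refine ⟨fun n => -Real.log (A n) / q n, ?_, ?_⟩
  · rw [Metric.tendsto_nhds]
    intro η hη
    have hd : 0 < min (1 / 10) (η / 10) := by positivity
    filter_upwards [main _ hd (min_le_left _ _)] with n ⟨_, hq0, _, _, h1, h2⟩
    have hle := min_le_right (1 / 10) (η / 10)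
    set d := min (1 / 10) (η / 10)
    have hA0 : 0 < A n := (Real.exp_pos _).trans_le h1
    rw [← Real.le_log_iff_exp_le hA0] at h1
    rw [← Real.log_le_iff_le_exp hA0] at h2
    have g1 : -Real.log (A n) / q n ≤ 1 + 5 * d := by
      rw [div_le_iff₀ hq0]; linarith
    have g2 : 1 - 5 * d ≤ -Real.log (A n) / q n := by
      rw [le_div_iff₀ hq0]; linarith
    rw [Real.dist_eq, abs_lt]
    constructor <;> linarith
  · filter_upwards [main (1 / 10) (by norm_num) le_rfl] with n ⟨hn, hq0, hμ0, hnt, h1, _⟩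
    have hA0 : 0 < A n := (Real.exp_pos _).trans_le h1
    have e1 : -(1 / 2) * (1 / μ n ^ 2) * Real.log (1 / ε n) ^ 2 * (-Real.log (A n) / q n)
        = Real.log (A n) := by
      have : -(1 / 2) * (1 / μ n ^ 2) * Real.log (1 / ε n) ^ 2 = - q n := by
        simp only [hq]; rw [div_pow]; ring
      rw [this]
      field_simp
    rw [e1, Real.exp_log hA0]
    have hn' : (0 : ℝ) < n := by exact_mod_cast hn
    have hs := hσ n
    have e2 : (n : ℝ) * σ n ^ 2 * (ε n * μ n ^ 2 - A n)
        = (xV n (k n) (τ n) (σ n)).toReal := by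
      simp only [hA, sub_sub_cancel]
      field_simp
    rw [e2, ENNReal.ofReal_toReal hnt]
    rfl
end
end

section
/- Consider the Gaussian sequence model with noise level σₙ and the SNR-aware parameter space Θ(kₙ, τₙ). Suppose εₙ = kₙ/n → 0, μₙ = τₙ/σₙ → ∞ and μₙ = o(√(log εₙ⁻¹)) as n → ∞. Then for all sufficiently large n, the optimally tuned hard thresholding estimator has supremum risk exactly: inf over λ > 0 of sup over θ ∈ Θ(kₙ,τₙ) of E_θ‖η̂_H(y,λ) − θ‖₂² = n σₙ² εₙ μₙ². -/
open MeasureTheory ProbabilityTheory Filter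
open scoped ENNReal NNReal Topology

noncomputable section

/-- Hard thresholding estimator `[η̂_H(y,λ)]ᵢ = yᵢ·1{|yᵢ| > λ}`. -/
def hardEst (n : ℕ) (lam : ℝ) : (Fin n → ℝ) → Fin n → ℝ :=
  fun y i => if lam < |y i| then y i else 0

lemma measurable_hardEst_sq (n : ℕ) (lam : ℝ) (θ : Fin n → ℝ) (i : Fin n) :
    Measurable (fun y : Fin n → ℝ => (hardEst n lam y i - θ i) ^ 2) := by
  have h : Measurable (fun y : Fin n → ℝ => hardEst n lam y i) := by
    unfold hardEst
    refine Measurable.ite ?_ (measurable_pi_apply i) measurable_const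
    exact measurableSet_lt measurable_const (measurable_pi_apply i).abs
  exact (h.sub_const _).pow_const 2

lemma measurable_ht (lam t : ℝ) :
    Measurable (fun x : ℝ => ((if lam < |x| then x else 0) - t) ^ 2) := by
  have h : Measurable (fun x : ℝ => if lam < |x| then x else 0) := by
    refine Measurable.ite ?_ measurable_id measurable_const
    exact measurableSet_lt measurable_const measurable_id.abs
  exact (h.sub_const _).pow_const 2

lemma risk_eq (n : ℕ) (σ lam : ℝ) (θ : Fin n → ℝ) :
    risk n σ (hardEst n lam) θ =
      ∑ i, ∫⁻ x, ENNReal.ofReal (((if lam < |x| then x else 0) - θ i) ^ 2)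
        ∂(gaussianReal (θ i) ((σ ^ 2).toNNReal)) := by
  unfold risk gsm
  have h1 : ∀ y : Fin n → ℝ, ENNReal.ofReal (∑ i, (hardEst n lam y i - θ i) ^ 2)
      = ∑ i, ENNReal.ofReal ((hardEst n lam y i - θ i) ^ 2) := fun y =>
    ENNReal.ofReal_sum_of_nonneg (fun i _ => sq_nonneg _)
  simp_rw [h1]
  rw [lintegral_finsetSum _ (fun i _ => (measurable_hardEst_sq n lam θ i).ennreal_ofReal)]
  refine Finset.sum_congr rfl fun i _ => ?_
  have hp := measurePreserving_eval (fun i => gaussianReal (θ i) ((σ ^ 2).toNNReal)) i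
  exact hp.lintegral_comp (measurable_ht lam (θ i)).ennreal_ofReal

/-- second-moment tail -/
def gtail (σ m : ℝ) : ℝ≥0∞ :=
  ∫⁻ x, (if m < |x| then ENNReal.ofReal (x ^ 2) else 0) ∂(gaussianReal 0 ((σ ^ 2).toNNReal))

lemma gtail_tendsto (σ : ℝ) : Tendsto (fun m : ℕ => gtail σ m) atTop (𝓝 0) := by
  unfold gtail
  have h0 : (0 : ℝ≥0∞) = ∫⁻ _x : ℝ, 0 ∂(gaussianReal 0 ((σ ^ 2).toNNReal)) := by simp
  rw [congrArg 𝓝 h0]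
  refine tendsto_lintegral_of_dominated_convergence (fun x => ENNReal.ofReal (x ^ 2)) ?_ ?_ ?_ ?_
  · intro m
    refine Measurable.ite ?_ (by fun_prop) measurable_const
    exact measurableSet_lt measurable_const measurable_id.abs
  · intro m
    refine ae_of_all _ fun x => ?_
    dsimp only
    split_ifs
    · exact le_rfl
    · simp
  · have : Integrable (fun x : ℝ => x ^ 2) (gaussianReal 0 ((σ ^ 2).toNNReal)) :=
      (memLp_id_gaussianReal 2).integrable_sq
    have h := this.lintegral_lt_top
    exact h.ne
  · refine ae_of_all _ fun x => ?_
    refine tendsto_const_nhds.congr' ?_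
    obtain ⟨N, hN⟩ := exists_nat_ge |x|
    filter_upwards [eventually_ge_atTop N] with m hm
    have : ((N : ℝ)) ≤ m := by exact_mod_cast hm
    rw [if_neg (by linarith)]

lemma coord_upper (σ B m t : ℝ) (ht : |t| ≤ B) :
    ∫⁻ x, ENNReal.ofReal (((if m + B < |x| then x else 0) - t) ^ 2)
        ∂(gaussianReal t ((σ ^ 2).toNNReal)) ≤ ENNReal.ofReal (t ^ 2) + gtail σ m := by
  have hmap : gaussianReal t ((σ ^ 2).toNNReal)
      = (gaussianReal 0 ((σ ^ 2).toNNReal)).map (· + t) := by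
    rw [gaussianReal_map_add_const]; simp
  rw [hmap, lintegral_map (measurable_ht _ _).ennreal_ofReal (by fun_prop)]
  unfold gtail
  have h1 : ENNReal.ofReal (t ^ 2) =
      ∫⁻ _x : ℝ, ENNReal.ofReal (t ^ 2) ∂(gaussianReal 0 ((σ ^ 2).toNNReal)) := by simp
  rw [h1, ← lintegral_add_left measurable_const]
  refine lintegral_mono fun x => ?_
  dsimp only
  by_cases h : m + B < |x + t|
  · have h2 : m < |x| := by
      have := abs_add_le x t
      linarith
    rw [if_pos h, if_pos h2]
    have : x + t - t = x := by ring
    rw [this]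
    exact le_add_self
  · rw [if_neg h]
    have : (0 - t) ^ 2 = t ^ 2 := by ring
    rw [this]
    exact le_self_add

lemma upper (n k : ℕ) (σ τ : ℝ) :
    (⨅ (lam : ℝ) (_ : 0 < lam), ⨆ θ ∈ paramSet n k τ, risk n σ (hardEst n lam) θ) ≤
      ENNReal.ofReal ((k : ℝ) * τ ^ 2) := by
  have hlim : Tendsto (fun m : ℕ => ENNReal.ofReal ((k : ℝ) * τ ^ 2) + (n : ℝ≥0∞) * gtail σ m)
      atTop (𝓝 (ENNReal.ofReal ((k : ℝ) * τ ^ 2))) := by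
    have h := ENNReal.Tendsto.const_mul (a := (n : ℝ≥0∞)) (gtail_tendsto σ)
      (Or.inr (ENNReal.natCast_ne_top n))
    have h2 := h.const_add (ENNReal.ofReal ((k : ℝ) * τ ^ 2))
    simpa using h2
  refine ge_of_tendsto hlim ?_
  filter_upwards [eventually_ge_atTop 1] with m hm
  have hm' : (1 : ℝ) ≤ m := by exact_mod_cast hm
  refine iInf₂_le_of_le ((m : ℝ) + Real.sqrt ((k : ℝ) * τ ^ 2))
    (by have := Real.sqrt_nonneg ((k : ℝ) * τ ^ 2); linarith) ?_
  refine iSup₂_le fun θ hθ => ?_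
  rw [risk_eq]
  have hs := hθ.2
  calc _ ≤ ∑ i, (ENNReal.ofReal ((θ i) ^ 2) + gtail σ m) := by
        refine Finset.sum_le_sum fun i _ => coord_upper _ _ _ _ ?_
        refine Real.abs_le_sqrt (le_trans ?_ hs)
        exact Finset.single_le_sum (f := fun i => (θ i) ^ 2) (fun i _ => sq_nonneg _)
          (Finset.mem_univ i)
    _ = ENNReal.ofReal (∑ i, (θ i) ^ 2) + (n : ℝ≥0∞) * gtail σ m := by
        rw [Finset.sum_add_distrib, ENNReal.ofReal_sum_of_nonneg (fun i _ => sq_nonneg _)]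
        simp
    _ ≤ _ := by gcongr

lemma gauss_lower (σ τ : ℝ) (hσ : 0 < σ) (hτ : σ ≤ τ) :
    ENNReal.ofReal (Real.exp (- (9 / 2 * (τ / σ) ^ 2)) / 4) ≤
      gaussianReal 0 ((σ ^ 2).toNNReal) (Set.Ioc (2 * τ) (2 * τ + σ)) := by
  have hv : (σ ^ 2).toNNReal ≠ 0 := by
    have : 0 < σ ^ 2 := by positivity
    simpa using this.ne'
  have hvc : (((σ ^ 2).toNNReal : ℝ≥0) : ℝ) = σ ^ 2 := Real.coe_toNNReal _ (sq_nonneg σ)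
  rw [gaussianReal_apply _ hv]
  set c : ℝ≥0∞ := ENNReal.ofReal (Real.exp (- (9 / 2 * (τ / σ) ^ 2)) / 4 / σ) with hc
  calc ENNReal.ofReal (Real.exp (- (9 / 2 * (τ / σ) ^ 2)) / 4)
      = ∫⁻ _x in Set.Ioc (2 * τ) (2 * τ + σ), c := by
        rw [setLIntegral_const, Real.volume_Ioc, hc, ← ENNReal.ofReal_mul (by positivity)]
        congr 1
        field_simp
        ring
    _ ≤ _ := by
        refine setLIntegral_mono (measurable_gaussianPDF _ _) fun x hx => ?_
        rw [hc, gaussianPDF]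
        refine ENNReal.ofReal_le_ofReal ?_
        rw [gaussianPDFReal, hvc]
        have hsq : Real.sqrt (2 * Real.pi * σ ^ 2) ≤ 4 * σ := by
          refine Real.sqrt_le_iff.2 ⟨by positivity, ?_⟩
          have := Real.pi_le_four
          nlinarith [sq_nonneg σ]
        have hpos : 0 < Real.sqrt (2 * Real.pi * σ ^ 2) := by
          have := Real.pi_pos
          positivity
        have h1 : (4 * σ)⁻¹ ≤ (Real.sqrt (2 * Real.pi * σ ^ 2))⁻¹ := inv_anti₀ hpos hsq
        have h2 : - (9 / 2 * (τ / σ) ^ 2) ≤ - (x - 0) ^ 2 / (2 * σ ^ 2) := by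
          have hx3 : x ≤ 3 * τ := by linarith [hx.2]
          have hx0 : 0 ≤ x := by linarith [hx.1]
          have : x ^ 2 ≤ 9 * τ ^ 2 := by nlinarith
          have h3 : 9 / 2 * (τ / σ) ^ 2 = 9 * τ ^ 2 / (2 * σ ^ 2) := by field_simp
          rw [h3, sub_zero, neg_div, neg_le_neg_iff]
          gcongr
        calc Real.exp (- (9 / 2 * (τ / σ) ^ 2)) / 4 / σ
            = (4 * σ)⁻¹ * Real.exp (- (9 / 2 * (τ / σ) ^ 2)) := by field_simp
          _ ≤ _ := by
            gcongr

lemma lower_small (n k : ℕ) (hn : 1 ≤ n) (σ τ lam : ℝ) (hσ : 0 < σ) (hτ : σ ≤ τ)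
    (hl : lam < 2 * τ) (hl0 : 0 < lam)
    (hε : (k : ℝ) / n ≤ Real.exp (- (9 / 2 * (τ / σ) ^ 2))) :
    ENNReal.ofReal ((k : ℝ) * τ ^ 2) ≤ risk n σ (hardEst n lam) 0 := by
  rw [risk_eq]
  have hn' : (0 : ℝ) < n := by exact_mod_cast hn
  have hcoord : ENNReal.ofReal ((k : ℝ) / n * τ ^ 2) ≤
      ∫⁻ x, ENNReal.ofReal (((if lam < |x| then x else 0) - 0) ^ 2)
        ∂(gaussianReal 0 ((σ ^ 2).toNNReal)) := by
    calc ENNReal.ofReal ((k : ℝ) / n * τ ^ 2)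
        ≤ ENNReal.ofReal ((4 * τ ^ 2) * (Real.exp (- (9 / 2 * (τ / σ) ^ 2)) / 4)) := by
          refine ENNReal.ofReal_le_ofReal ?_
          nlinarith [sq_nonneg τ]
      _ = ENNReal.ofReal (4 * τ ^ 2) * ENNReal.ofReal (Real.exp (- (9 / 2 * (τ / σ) ^ 2)) / 4) :=
          ENNReal.ofReal_mul (by positivity)
      _ ≤ ENNReal.ofReal (4 * τ ^ 2) *
          gaussianReal 0 ((σ ^ 2).toNNReal) (Set.Ioc (2 * τ) (2 * τ + σ)) := by
          gcongr
          exact gauss_lower σ τ hσ hτ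
      _ = ∫⁻ _x in Set.Ioc (2 * τ) (2 * τ + σ), ENNReal.ofReal (4 * τ ^ 2)
          ∂(gaussianReal 0 ((σ ^ 2).toNNReal)) := by rw [setLIntegral_const]
      _ ≤ ∫⁻ x in Set.Ioc (2 * τ) (2 * τ + σ),
          ENNReal.ofReal (((if lam < |x| then x else 0) - 0) ^ 2)
          ∂(gaussianReal 0 ((σ ^ 2).toNNReal)) := by
          refine setLIntegral_mono (measurable_ht _ _).ennreal_ofReal fun x hx => ?_
          refine ENNReal.ofReal_le_ofReal ?_
          have h1 : lam < |x| := lt_of_lt_of_le (hl.trans hx.1) (le_abs_self x)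
          rw [if_pos h1]
          nlinarith [hx.1]
      _ ≤ _ := setLIntegral_le_lintegral _ _
  calc ENNReal.ofReal ((k : ℝ) * τ ^ 2)
      = ∑ _i : Fin n, ENNReal.ofReal ((k : ℝ) / n * τ ^ 2) := by
        rw [Finset.sum_const, Finset.card_univ, Fintype.card_fin, nsmul_eq_mul,
          ← ENNReal.ofReal_natCast, ← ENNReal.ofReal_mul (by positivity)]
        congr 1
        field_simp
    _ ≤ _ := Finset.sum_le_sum fun i _ => hcoord

lemma lower_large (n k : ℕ) (hk : k ≤ n) (σ τ lam : ℝ) (hτ : 0 < τ)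
    (hl : 2 * τ ≤ lam) :
    ENNReal.ofReal ((k : ℝ) * τ ^ 2) ≤
      ⨆ θ ∈ paramSet n k τ, risk n σ (hardEst n lam) θ := by
  obtain ⟨s, -, hs⟩ := Finset.exists_subset_card_eq (s := (Finset.univ : Finset (Fin n)))
    (n := k) (by simpa using hk)
  set θ : Fin n → ℝ := fun i => if i ∈ s then τ else 0 with hθ
  have hsum : ∑ i, (θ i) ^ 2 = (k : ℝ) * τ ^ 2 := by
    simp [hθ, ite_pow, hs]
  have hmem : θ ∈ paramSet n k τ := by
    refine ⟨?_, hsum.le⟩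
    have : {i | θ i ≠ 0} ⊆ (s : Set (Fin n)) := by
      intro i hi
      by_contra h
      exact hi (if_neg h)
    calc _ ≤ (s : Set (Fin n)).ncard := Set.ncard_le_ncard this s.finite_toSet
      _ = k := by rw [Set.ncard_coe_finset, hs]
  refine le_iSup₂_of_le θ hmem ?_
  rw [risk_eq, ← hsum, ENNReal.ofReal_sum_of_nonneg (fun i _ => sq_nonneg _)]
  refine Finset.sum_le_sum fun i _ => ?_
  calc ENNReal.ofReal (θ i ^ 2)
      = ∫⁻ _x, ENNReal.ofReal (θ i ^ 2) ∂(gaussianReal (θ i) ((σ ^ 2).toNNReal)) := by simp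
    _ ≤ _ := by
      refine lintegral_mono fun x => ENNReal.ofReal_le_ofReal ?_
      have h0 : 0 ≤ θ i ∧ θ i ≤ τ := by
        simp only [hθ]; split_ifs <;> constructor <;> linarith
      split_ifs with h
      · rcases lt_abs.1 h with h | h <;> nlinarith [h0.1, h0.2]
      · nlinarith

/-- Proposition `lem::hardthreshold-risk-regime-2`. -/
theorem statement6
    (k : ℕ → ℕ) (τ σ ε μ : ℕ → ℝ)
    (hk : ∀ n, 1 ≤ n → 1 ≤ k n ∧ k n ≤ n)
    (hτ : ∀ n, 0 < τ n) (hσ : ∀ n, 0 < σ n)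
    (hε : ∀ n, ε n = (k n : ℝ) / n) (hμ : ∀ n, μ n = τ n / σ n)
    (hε0 : Tendsto ε atTop (𝓝 0)) (hμtop : Tendsto μ atTop atTop)
    (hμo : Tendsto (fun n => μ n / Real.sqrt (Real.log (ε n)⁻¹)) atTop (𝓝 0)) :
    ∀ᶠ n : ℕ in atTop,
      (⨅ (lam : ℝ) (_ : 0 < lam),
          ⨆ θ ∈ paramSet n (k n) (τ n), risk n (σ n) (hardEst n lam) θ) =
        ENNReal.ofReal ((n : ℝ) * σ n ^ 2 * ε n * μ n ^ 2) := by
  have hlog : ∀ᶠ n in atTop, ε n < 1 := hε0.eventually_lt_const one_pos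
  have hr : ∀ᶠ n in atTop, μ n / Real.sqrt (Real.log (ε n)⁻¹) < 1 / 3 :=
    hμo.eventually_lt_const (by norm_num)
  filter_upwards [hlog, hr, hμtop.eventually_ge_atTop 1, eventually_ge_atTop 1] with
    n hε1 hr hμ1 hn
  obtain ⟨hk1, hkn⟩ := hk n hn
  have hn' : (0 : ℝ) < n := by exact_mod_cast hn
  have hk' : (0 : ℝ) < k n := by exact_mod_cast hk1
  have hσn := hσ n
  have hτn := hτ n
  have hεpos : 0 < ε n := by rw [hε]; positivity
  have hL : 0 < Real.log (ε n)⁻¹ := Real.log_pos ((one_lt_inv₀ hεpos).2 hε1)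
  have hS : 0 < Real.sqrt (Real.log (ε n)⁻¹) := Real.sqrt_pos.2 hL
  have hμL : 9 / 2 * μ n ^ 2 ≤ Real.log (ε n)⁻¹ := by
    rw [div_lt_iff₀ hS] at hr
    have := Real.sq_sqrt hL.le
    nlinarith
  have hεexp : ε n ≤ Real.exp (-(9 / 2 * μ n ^ 2)) := by
    rw [← Real.log_le_iff_le_exp hεpos]
    rw [Real.log_inv] at hμL
    linarith
  rw [hε n, hμ n] at hεexp
  have hστ : σ n ≤ τ n := by
    rw [hμ, le_div_iff₀ hσn] at hμ1
    linarith
  have hval : (n : ℝ) * σ n ^ 2 * ε n * μ n ^ 2 = (k n : ℝ) * τ n ^ 2 := by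
    rw [hε, hμ]
    field_simp
  rw [hval]
  refine le_antisymm (upper _ _ _ _) ?_
  refine le_iInf₂ fun lam hlam => ?_
  rcases lt_or_ge lam (2 * τ n) with h | h
  · have hz : (0 : Fin n → ℝ) ∈ paramSet n (k n) (τ n) := by
      refine ⟨by simp, ?_⟩
      simp only [Pi.zero_apply]
      simp
      positivity
    exact le_iSup₂_of_le 0 hz (lower_small n (k n) hn _ _ _ hσn hστ h hlam hεexp)
  · exact lower_large n (k n) hkn _ _ _ hτn h
end
end

section
/- Consider the Gaussian sequence model with noise level σₙ and the SNR-aware parameter space Θ(kₙ, τₙ). Then for every n, the optimally tuned linear estimator has supremum risk exactly: inf over λ ≥ 0 of sup over θ ∈ Θ(kₙ,τₙ) of E_θ‖η̂_L(y,λ) − θ‖₂² = n σₙ² ( εₙ μₙ² − εₙ² μₙ⁴/(1 + εₙ μₙ²) ) = n σₙ² εₙ μₙ² / (1 + εₙ μₙ²), where εₙ = kₙ/n and μₙ = τₙ/σₙ. -/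
open MeasureTheory ProbabilityTheory Filter
open scoped ENNReal NNReal Topology

noncomputable section

/-- Linear (ridge) estimator `[η̂_L(y,λ)]ᵢ = yᵢ/(1+λ)`. -/
def linEst (n : ℕ) (lam : ℝ) : (Fin n → ℝ) → Fin n → ℝ := fun y i => y i / (1 + lam)

lemma coord_aux (m a : ℝ) (v : ℝ≥0) :
    ∫⁻ y, ENNReal.ofReal ((a * y - m) ^ 2) ∂(gaussianReal m v) =
      ENNReal.ofReal (a ^ 2 * v + (1 - a) ^ 2 * m ^ 2) := by
  have hid : MemLp (fun y : ℝ => y) 2 (gaussianReal m v) := memLp_id_gaussianReal 2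
  have hX : MemLp (fun y : ℝ => a * y - m) 2 (gaussianReal m v) :=
    (hid.const_mul a).sub (memLp_const m)
  rw [← ofReal_integral_eq_lintegral_ofReal hX.integrable_sq
    (Filter.Eventually.of_forall fun y => sq_nonneg _)]
  congr 1
  have h1 := variance_eq_sub hX
  have h2 : Var[fun y : ℝ => a * y - m; gaussianReal m v] = a ^ 2 * v := by
    rw [variance_sub_const (hid.const_mul a).aestronglyMeasurable, variance_const_mul,
      variance_fun_id_gaussianReal]
  have h3 : ∫ y, (a * y - m) ∂(gaussianReal m v) = a * m - m := by
    rw [integral_sub ((hid.integrable (by norm_num)).const_mul a) (integrable_const m),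
      integral_const_mul, integral_id_gaussianReal]
    simp
  rw [h2, h3] at h1
  have h4 : (∫ y, (a * y - m) ^ 2 ∂(gaussianReal m v)) = a ^ 2 * v + (a * m - m) ^ 2 := by
    have : (∫ y, (a * y - m) ^ 2 ∂(gaussianReal m v))
      = ∫ y, ((fun y : ℝ => a * y - m) ^ 2) y ∂(gaussianReal m v) := rfl
    rw [this]; linarith
  rw [h4]; ring

lemma risk_aux (n : ℕ) (σ lam : ℝ) (θ : Fin n → ℝ) :
    risk n σ (linEst n lam) θ = ENNReal.ofReal
      (n * σ ^ 2 * (1 / (1 + lam)) ^ 2 + (1 - 1 / (1 + lam)) ^ 2 * ∑ i, θ i ^ 2) := by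
  unfold risk gsm linEst
  have : ∀ y : Fin n → ℝ, ENNReal.ofReal (∑ i, (y i / (1 + lam) - θ i) ^ 2) =
      ∑ i, ENNReal.ofReal ((1 / (1 + lam) * y i - θ i) ^ 2) := by
    intro y
    rw [ENNReal.ofReal_sum_of_nonneg (fun i _ => sq_nonneg _)]
    refine Finset.sum_congr rfl fun i _ => ?_
    congr 2; ring
  simp_rw [this]
  rw [lintegral_finsetSum _ (fun i _ => by fun_prop)]
  have h : ∀ i, ∫⁻ y : Fin n → ℝ, ENNReal.ofReal ((1 / (1 + lam) * y i - θ i) ^ 2)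
      ∂(Measure.pi fun i => gaussianReal (θ i) ((σ ^ 2).toNNReal)) =
      ENNReal.ofReal ((1 / (1 + lam)) ^ 2 * σ ^ 2 + (1 - 1 / (1 + lam)) ^ 2 * θ i ^ 2) := by
    intro i
    have hm := measurePreserving_eval (fun i => gaussianReal (θ i) ((σ ^ 2).toNNReal)) i
    have := hm.lintegral_comp
      (f := fun y => ENNReal.ofReal ((1 / (1 + lam) * y - θ i) ^ 2)) (by fun_prop)
    simp only [Function.eval] at this
    rw [this, coord_aux, Real.coe_toNNReal _ (sq_nonneg σ)]
  simp_rw [h]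
  rw [← ENNReal.ofReal_sum_of_nonneg (fun i _ => by positivity)]
  congr 1
  rw [Finset.sum_add_distrib, Finset.sum_const, ← Finset.mul_sum, Finset.card_univ, Fintype.card_fin, nsmul_eq_mul]
  ring

lemma sup_aux (n k : ℕ) (τ σ lam : ℝ) (hk1 : 1 ≤ k) (hk2 : k ≤ n) :
    (⨆ θ ∈ paramSet n k τ, risk n σ (linEst n lam) θ) = ENNReal.ofReal
      (n * σ ^ 2 * (1 / (1 + lam)) ^ 2 + (1 - 1 / (1 + lam)) ^ 2 * (k * τ ^ 2)) := by
  apply le_antisymm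
  · refine iSup₂_le fun θ hθ => ?_
    rw [risk_aux]
    apply ENNReal.ofReal_le_ofReal
    have := mul_le_mul_of_nonneg_left hθ.2 (sq_nonneg (1 - 1 / (1 + lam)))
    linarith
  · have hn : 0 < n := by omega
    let i0 : Fin n := ⟨0, hn⟩
    let θ : Fin n → ℝ := Pi.single i0 (√(k * τ ^ 2))
    have hs : ∑ i, θ i ^ 2 = k * τ ^ 2 := by
      rw [Finset.sum_eq_single i0]
      · simp only [θ, Pi.single_eq_same]
        exact Real.sq_sqrt (by positivity)
      · intro b _ hb
        simp [θ, hb]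
      · simp
    have hθ : θ ∈ paramSet n k τ := by
      refine ⟨?_, hs.le⟩
      refine le_trans ?_ hk1
      rw [← Set.ncard_singleton i0]
      refine Set.ncard_le_ncard ?_ (Set.toFinite _)
      intro i hi
      by_contra hne
      exact hi (by simp at hne; simp [θ, hne])
    refine le_trans (le_of_eq ?_) (le_iSup₂ (f := fun θ _ => risk n σ (linEst n lam) θ) θ hθ)
    rw [risk_aux, hs]

/-- Proposition `lem::ridge-risk-regime-2` / `prop:ridge:thirdregime`,
exact supremum risk of the optimally tuned linear estimator, valid for every `n`. -/
theorem statement7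
    (n k : ℕ) (τ σ ε μ : ℝ)
    (hk1 : 1 ≤ k) (hk2 : k ≤ n) (hτ : 0 < τ) (hσ : 0 < σ)
    (hε : ε = (k : ℝ) / n) (hμ : μ = τ / σ) :
    (⨅ (lam : ℝ) (_ : 0 ≤ lam),
        ⨆ θ ∈ paramSet n k τ, risk n σ (linEst n lam) θ) =
      ENNReal.ofReal ((n : ℝ) * σ ^ 2 * (ε * μ ^ 2 - ε ^ 2 * μ ^ 4 / (1 + ε * μ ^ 2))) ∧
    (⨅ (lam : ℝ) (_ : 0 ≤ lam),
        ⨆ θ ∈ paramSet n k τ, risk n σ (linEst n lam) θ) =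
      ENNReal.ofReal ((n : ℝ) * σ ^ 2 * ε * μ ^ 2 / (1 + ε * μ ^ 2)) := by
  have hn : (0 : ℝ) < n := by exact_mod_cast (by omega : 0 < n)
  have hk : (0 : ℝ) < k := by exact_mod_cast hk1
  have hA : 0 < (n : ℝ) * σ ^ 2 := by positivity
  have hB : 0 < (k : ℝ) * τ ^ 2 := by positivity
  have key : (⨅ (lam : ℝ) (_ : 0 ≤ lam),
        ⨆ θ ∈ paramSet n k τ, risk n σ (linEst n lam) θ) =
      ENNReal.ofReal ((n * σ ^ 2) * (k * τ ^ 2) / (n * σ ^ 2 + k * τ ^ 2)) := by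
    simp_rw [sup_aux n k τ σ _ hk1 hk2]
    generalize (n : ℝ) * σ ^ 2 = A at *
    generalize (k : ℝ) * τ ^ 2 = B at *
    apply le_antisymm
    · refine iInf₂_le_of_le (A / B) (by positivity) (le_of_eq ?_)
      congr 1
      field_simp
      ring
    · refine le_iInf₂ fun lam _ => ENNReal.ofReal_le_ofReal ?_
      rw [div_le_iff₀ (by positivity)]
      generalize 1 / (1 + lam) = a
      nlinarith [sq_nonneg (a * A - (1 - a) * B)]
  have e1 : ε * μ ^ 2 = (k * τ ^ 2) / (n * σ ^ 2) := by
    rw [hε, hμ]; field_simp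
  have hp : 0 < 1 + ε * μ ^ 2 := by rw [e1]; positivity
  have e2 : (n : ℝ) * σ ^ 2 * ε * μ ^ 2 / (1 + ε * μ ^ 2) =
      (n * σ ^ 2) * (k * τ ^ 2) / (n * σ ^ 2 + k * τ ^ 2) := by
    rw [mul_assoc _ ε, e1]; field_simp
  have e3 : (n : ℝ) * σ ^ 2 * (ε * μ ^ 2 - ε ^ 2 * μ ^ 4 / (1 + ε * μ ^ 2)) =
      (n : ℝ) * σ ^ 2 * ε * μ ^ 2 / (1 + ε * μ ^ 2) := by
    field_simp; ring
  rw [e3, e2]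
  exact ⟨key, key⟩
end
end
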